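/- There exists no self-dual [24,12,10] code over the field F5. That is, there is no 12-dimensional linear subspace C of (F5)^24 which equals its dual code under the standard inner product and whose minimum Hamming weight (the smallest Hamming weight among nonzero codewords) is 10. -/

import Mathlib

namespace SD24

abbrev V := Fin 24 → ZMod 5

/-- The standing hypotheses on the code. -/
structure Good (C : Submodule (ZMod 5) V) : Prop where
  rank : Module.finrank (ZMod 5) C = 12
  dual : ∀ x : V, x ∈ C ↔ ∀ c ∈ C, ∑ i, x i * c i = 0
  wt : ∀ c ∈ C, c ≠ 0 → 10 ≤ hammingNorm c

/-- restriction of codewords to a set of coordinates -/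
def restr (C : Submodule (ZMod 5) V) (S : Finset (Fin 24)) : C →ₗ[ZMod 5] (S → ZMod 5) :=
  (LinearMap.funLeft (ZMod 5) (ZMod 5) (fun s : S => (s : Fin 24))).comp C.subtype

lemma restr_apply (C : Submodule (ZMod 5) V) (S : Finset (Fin 24)) (c : C) (s : S) :
    restr C S c s = (c : V) s := rfl

lemma fact_five : Fact (Nat.Prime 5) := ⟨by norm_num⟩

attribute [local instance] fact_five

lemma restr_surj {C : Submodule (ZMod 5) V} (h : Good C) (S : Finset (Fin 24))
    (hS : S.card ≤ 9) : Function.Surjective (restr C S) := by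
  classical
  rw [← LinearMap.range_eq_top]
  by_contra hne
  obtain ⟨f, hf0, hf⟩ := Submodule.exists_le_ker_of_lt_top _ (lt_top_iff_ne_top.mpr hne)
  let x : V := fun i => if hi : i ∈ S then f (Pi.single ⟨i, hi⟩ 1) else 0
  have hfx : ∀ v : S → ZMod 5, f v = ∑ s : S, x s * v s := by
    intro v
    conv_lhs => rw [← Finset.univ_sum_single v]
    rw [map_sum]
    refine Finset.sum_congr rfl fun s _ => ?_
    have : (Pi.single s (v s) : S → ZMod 5) = v s • Pi.single s 1 := by
      rw [← Pi.single_smul]; simp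
    rw [this, map_smul]
    simp [x, mul_comm]
  have hxC : x ∈ C := by
    rw [h.dual]
    intro c hc
    have h1 : f (restr C S ⟨c, hc⟩) = 0 := hf ⟨_, rfl⟩
    rw [hfx] at h1
    rw [← h1]
    symm
    simp only [restr_apply]
    rw [Finset.sum_coe_sort S (fun i => x i * c i)]
    refine Finset.sum_subset (Finset.subset_univ _) ?_
    intro i _ hi
    simp [x, hi]
  have hx0 : x ≠ 0 := by
    intro hx
    apply hf0
    refine LinearMap.ext fun v => ?_
    rw [hfx]
    simp [hx]
  have h2 := h.wt x hxC hx0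
  have h3 : hammingNorm x ≤ S.card := by
    unfold hammingNorm
    apply Finset.card_le_card
    intro i hi
    by_contra hiS
    simp [x, hiS] at hi
  omega

lemma card_C {C : Submodule (ZMod 5) V} (h : Good C) : Nat.card C = 5 ^ 12 := by
  rw [Module.natCard_eq_pow_finrank (K := ZMod 5), h.rank]; simp

open Classical in
lemma oa {C : Submodule (ZMod 5) V} (h : Good C) (S : Finset (Fin 24))
    (hS : S.card ≤ 9) (B : Fin 24 → Finset (ZMod 5)) (hB : ∀ i, (B i).card = 2) :
    (Finset.univ.filter (fun c : C => ∀ k ∈ S, (c : V) k ∈ B k)).card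
      = 2 ^ S.card * 5 ^ (12 - S.card) := by
  have hs := restr_surj h S hS
  have hcard : Fintype.card C = 5 ^ 12 := by rw [← card_C h, Nat.card_eq_fintype_card]
  -- fibres all have the same size
  have hfib : ∀ y : S → ZMod 5, (Finset.univ.filter (fun c : C => restr C S c = y)).card
      = (Finset.univ.filter (fun c : C => restr C S c = 0)).card := by
    intro y
    obtain ⟨c0, hc0⟩ := hs y
    refine Finset.card_bij' (fun c _ => c - c0) (fun c _ => c + c0) ?_ ?_ ?_ ?_
    · intro c hc; simp at hc ⊢; simp [hc, hc0]
    · intro c hc; simp at hc ⊢; simp [hc, hc0]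
    · intro c _; simp
    · intro c _; simp
  set K := (Finset.univ.filter (fun c : C => restr C S c = 0)).card with hK
  have htot : 5 ^ 12 = 5 ^ S.card * K := by
    have := Finset.card_eq_sum_card_fiberwise (s := (Finset.univ : Finset C))
      (t := (Finset.univ : Finset (S → ZMod 5))) (f := restr C S) (by intro _ _; simp)
    rw [Finset.card_univ, hcard] at this
    rw [this, Finset.sum_congr rfl (fun y _ => hfib y)]
    simp
  have hKv : K = 5 ^ (12 - S.card) := by
    have : 5 ^ 12 = 5 ^ S.card * 5 ^ (12 - S.card) := by
      rw [← pow_add]; congr 1; omega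
    rw [this] at htot
    exact (Nat.eq_of_mul_eq_mul_left (by positivity) htot).symm
  have := Finset.card_eq_sum_card_fiberwise
      (s := Finset.univ.filter (fun c : C => ∀ k ∈ S, (c : V) k ∈ B k))
      (t := Fintype.piFinset (fun s : S => B s)) (f := restr C S) (by
        intro c hc
        simp at hc ⊢
        intro a ha
        exact hc a ha)
  rw [this]
  have h2 : ∀ y ∈ Fintype.piFinset (fun s : S => B s),
      ((Finset.univ.filter (fun c : C => ∀ k ∈ S, (c : V) k ∈ B k)).filter
        (fun c => restr C S c = y)).card = K := by
    intro y hy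
    rw [← hfib y, Finset.filter_filter]
    congr 1
    ext c
    simp only [Finset.mem_filter, Finset.mem_univ, true_and, and_iff_right_iff_imp]
    intro hc k hk
    have := (Fintype.mem_piFinset.mp hy) ⟨k, hk⟩
    rw [← hc] at this
    exact this
  rw [Finset.sum_congr rfl h2]
  simp [hB, hKv]

/-- number of coordinates equal to `±1` -/
def n1 (c : V) : ℕ := (Finset.univ.filter (fun i => c i = 1 ∨ c i = 4)).card
/-- number of coordinates equal to `±2` -/
def n2 (c : V) : ℕ := (Finset.univ.filter (fun i => c i = 2 ∨ c i = 3)).card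

open Classical in
lemma moment {C : Submodule (ZMod 5) V} (h : Good C) (i j : ℕ) (hij : i + j ≤ 9) :
    ∑ c : C, (n1 c).choose i * (n2 c).choose j
      = Nat.choose 24 i * Nat.choose (24 - i) j * (2 ^ (i + j) * 5 ^ (12 - (i + j))) := by
  let A1 : V → Finset (Fin 24) := fun c => Finset.univ.filter (fun k => c k = 1 ∨ c k = 4)
  let A2 : V → Finset (Fin 24) := fun c => Finset.univ.filter (fun k => c k = 2 ∨ c k = 3)
  have e1 : ∀ c : V, (n1 c).choose i * (n2 c).choose j =
      ∑ I ∈ Finset.powersetCard i (Finset.univ : Finset (Fin 24)),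
        ∑ J ∈ Finset.powersetCard j (Finset.univ : Finset (Fin 24)),
          if I ⊆ A1 c ∧ J ⊆ A2 c then 1 else 0 := by
    intro c
    have hh : ∀ (i : ℕ) (A : Finset (Fin 24)), (A.card).choose i =
        ∑ I ∈ Finset.powersetCard i (Finset.univ : Finset (Fin 24)), if I ⊆ A then 1 else 0 := by
      intro i A
      rw [← Finset.card_powersetCard, Finset.sum_boole, Nat.cast_id]
      congr 1
      ext I
      simp [Finset.mem_powersetCard, and_comm]
    have a1 := hh i (A1 c)
    have a2 := hh j (A2 c)
    change (A1 c).card.choose i * (A2 c).card.choose j = _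
    rw [a1, a2, Finset.sum_mul_sum]
    refine Finset.sum_congr rfl fun I _ => Finset.sum_congr rfl fun J _ => ?_
    split_ifs <;> simp_all
  simp_rw [e1]
  rw [Finset.sum_comm]
  have e2 : ∀ I ∈ Finset.powersetCard i (Finset.univ : Finset (Fin 24)),
      (∑ c : C, ∑ J ∈ Finset.powersetCard j (Finset.univ : Finset (Fin 24)),
          if I ⊆ A1 c ∧ J ⊆ A2 c then 1 else 0)
      = Nat.choose (24 - i) j * (2 ^ (i + j) * 5 ^ (12 - (i + j))) := by
    intro I hI
    rw [Finset.mem_powersetCard] at hI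
    rw [Finset.sum_comm]
    have e3 : ∀ J ∈ Finset.powersetCard j (Finset.univ : Finset (Fin 24)),
        (∑ c : C, if I ⊆ A1 c ∧ J ⊆ A2 c then 1 else 0)
        = if J ⊆ Iᶜ then (2 ^ (i + j) * 5 ^ (12 - (i + j))) else 0 := by
      intro J hJ
      rw [Finset.mem_powersetCard] at hJ
      rw [Finset.sum_boole, Nat.cast_id]
      split_ifs with hd
      · have hdis : Disjoint I J := by
          rw [Finset.disjoint_right]; intro a ha; simpa using hd ha
        have hc : (I ∪ J).card = i + j := by
          rw [Finset.card_union_of_disjoint hdis, hI.2, hJ.2]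
        have := oa h (I ∪ J) (by omega) (fun k => if k ∈ I then {1, 4} else {2, 3})
          (by intro k; split_ifs <;> decide)
        rw [hc] at this
        rw [← this]
        congr 1
        ext c
        simp only [Finset.mem_filter, Finset.mem_univ, true_and]
        constructor
        · rintro ⟨h1, h2⟩ k hk
          by_cases hkI : k ∈ I
          · have := h1 hkI
            simpa [A1, hkI] using this
          · have := h2 ((Finset.mem_union.mp hk).resolve_left hkI)
            simpa [A2, hkI] using this
        · intro h1
          constructor
          · intro k hk
            have := h1 k (Finset.mem_union_left _ hk)
            simpa [A1, hk] using this
          · intro k hk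
            have := h1 k (Finset.mem_union_right _ hk)
            have hkI : k ∉ I := by simpa using hd hk
            simpa [A2, hkI] using this
      · rw [Finset.card_eq_zero, Finset.filter_eq_empty_iff]
        rintro c _ ⟨h1, h2⟩
        apply hd
        intro k hk
        rw [Finset.mem_compl]
        intro hkI
        have a := h1 hkI
        have b := h2 hk
        simp only [A1, A2, Finset.mem_filter, Finset.mem_univ, true_and] at a b
        revert a b
        generalize (c : V) k = y
        revert y; decide
    rw [Finset.sum_congr rfl e3, ← Finset.sum_filter, Finset.sum_const, smul_eq_mul]
    congr 1
    have : (Finset.powersetCard j (Finset.univ : Finset (Fin 24))).filter (fun J => J ⊆ Iᶜ)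
        = Finset.powersetCard j Iᶜ := by
      ext J
      simp [Finset.mem_powersetCard, and_comm]
    rw [this, Finset.card_powersetCard, Finset.card_compl, hI.2]
    simp
  rw [Finset.sum_congr rfl e2]
  simp [mul_assoc]

end SD24

namespace SD24

attribute [local instance] fact_five

/-- certificate coefficients -/
def lamA : List (ℕ × ℕ × ℤ) :=
  [
   (0, 0, -202702500000000), (1, 0, 87116552683776), (0, 1, 87116552683776), (2, 0, -17831335915008),
   (0, 2, -17831335915008), (1, 1, -33900605367552), (3, 0, 2291310395136), (0, 3, 2291310395136),
   (2, 1, 6189977211264), (1, 2, 6189977211264), (4, 0, -204364856304), (0, 4, -204364856304),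
   (3, 1, -696820973184), (1, 3, -696820973184), (2, 2, -987065823744), (5, 0, 13148866080),
   (0, 5, 13148866080), (4, 1, 53157867840), (1, 4, 53157867840), (3, 2, 94442604480),
   (2, 3, 94442604480), (6, 0, -611186184), (0, 6, -611186184), (5, 1, -2823868656),
   (1, 5, -2823868656), (4, 2, -5897571120), (2, 4, -5897571120), (3, 3, -7366222080),
   (7, 0, 19815048), (0, 7, 19815048), (6, 1, 102243960), (1, 6, 102243960),
   (5, 2, 241709832), (2, 5, 241709832), (4, 3, 352001160), (3, 4, 352001160),
   (8, 0, -406899), (0, 8, -406899), (7, 1, -2311848), (1, 7, -2311848),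
   (6, 2, -6039432), (2, 6, -6039432), (5, 3, -9860256), (3, 5, -9860256),
   (4, 4, -11419380), (9, 0, 4030), (0, 9, 4030), (8, 1, 25065),
   (1, 8, 25065), (7, 2, 71100), (2, 7, 71100), (6, 3, 127260),
   (3, 6, 127260), (5, 4, 163170), (4, 5, 163170)]

/-- certificate coefficients -/
def lamB : List (ℕ × ℕ × ℤ) :=
  [
   (0, 0, 0), (1, 0, -12241152), (0, 1, -12241152), (2, 0, -7362432),
   (0, 2, -7362432), (1, 1, 24482304), (3, 0, 3576384), (0, 3, 3576384),
   (2, 1, -4346496), (1, 2, -4346496), (4, 0, 38304), (0, 4, 38304),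
   (3, 1, -1888320), (1, 3, -1888320), (2, 2, 3814272), (5, 0, -89376),
   (0, 5, -89376), (4, 1, 357168), (1, 4, 357168), (3, 2, -269472),
   (2, 3, -269472), (6, 0, 2688), (0, 6, 2688), (5, 1, 14112),
   (1, 5, 14112), (4, 2, -87360), (2, 4, -87360), (3, 3, 141120),
   (7, 0, 560), (0, 7, 560), (6, 1, -3640), (1, 6, -3640),
   (5, 2, 7560), (2, 5, 7560), (4, 3, -4480), (3, 4, -4480),
   (8, 0, -12), (0, 8, -12), (7, 1, -16), (1, 7, -16),
   (6, 2, 336), (2, 6, 336), (5, 3, -1008), (3, 5, -1008),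
   (4, 4, 1400), (9, 0, -1), (0, 9, -1), (8, 1, 7),
   (1, 8, 7), (7, 2, -20), (2, 7, -20), (6, 3, 28),
   (3, 6, 28), (5, 4, -14), (4, 5, -14)]

/-- evaluation of a certificate at a type -/
def evalP (l : List (ℕ × ℕ × ℤ)) (a b : ℕ) : ℤ :=
  (l.map (fun t => t.2.2 * ((a.descFactorial t.1 * b.descFactorial t.2.1 : ℕ) : ℤ))).sum

/-- total of a certificate over the code -/
def totP (l : List (ℕ × ℕ × ℤ)) : ℤ :=
  (l.map (fun t => t.2.2 * ((Nat.descFactorial 24 t.1 * Nat.descFactorial (24 - t.1) t.2.1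
    * (2 ^ (t.1 + t.2.1) * 5 ^ (12 - (t.1 + t.2.1))) : ℕ) : ℤ))).sum

open Classical in
lemma sum_evalP {C : Submodule (ZMod 5) V} (h : Good C) (l : List (ℕ × ℕ × ℤ))
    (hl : ∀ t ∈ l, t.1 + t.2.1 ≤ 9) :
    ∑ c : C, evalP l (n1 c) (n2 c) = totP l := by
  induction l with
  | nil => simp [evalP, totP]
  | cons t l ih =>
    have ih' := ih (fun s hs => hl s (List.mem_cons_of_mem _ hs))
    have ht := hl t List.mem_cons_self
    have hm := moment h t.1 t.2.1 ht
    have e : ∀ a b, evalP (t :: l) a b =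
        t.2.2 * ((a.descFactorial t.1 * b.descFactorial t.2.1 : ℕ) : ℤ) + evalP l a b := by
      intro a b; simp [evalP]
    simp_rw [e]
    rw [Finset.sum_add_distrib, ih', ← Finset.mul_sum, ← Nat.cast_sum]
    have e2 : totP (t :: l) = t.2.2 * ((Nat.descFactorial 24 t.1 * Nat.descFactorial (24 - t.1) t.2.1
        * (2 ^ (t.1 + t.2.1) * 5 ^ (12 - (t.1 + t.2.1))) : ℕ) : ℤ) + totP l := by
      simp only [totP, List.map_cons, List.sum_cons]
    rw [e2]
    congr 3
    simp_rw [Nat.descFactorial_eq_factorial_mul_choose]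
    have : ∀ c : C, Nat.factorial t.1 * (n1 c).choose t.1 * (Nat.factorial t.2.1 * (n2 c).choose t.2.1)
      = Nat.factorial t.1 * Nat.factorial t.2.1 * ((n1 c).choose t.1 * (n2 c).choose t.2.1) := by
      intro c; ring
    simp_rw [this]
    rw [← Finset.mul_sum, hm]
    ring

lemma hamming_eq (c : V) : hammingNorm c = n1 c + n2 c := by
  unfold hammingNorm n1 n2
  rw [← Finset.card_union_of_disjoint]
  · congr 1
    ext i
    simp only [Finset.mem_filter, Finset.mem_univ, true_and, Finset.mem_union]
    have key : ∀ y : ZMod 5, y ≠ 0 ↔ (y = 1 ∨ y = 4) ∨ y = 2 ∨ y = 3 := by decide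
    exact key (c i)
  · rw [Finset.disjoint_filter]
    intro i _
    generalize c i = y
    revert y; decide

lemma sq_sum (c : V) : ∑ i, c i * c i = ((n1 c + 4 * n2 c : ℕ) : ZMod 5) := by
  have : ∀ i, c i * c i = (if c i = 1 ∨ c i = 4 then 1 else 0)
      + 4 * (if c i = 2 ∨ c i = 3 then 1 else 0) := by
    intro i
    generalize c i = y
    revert y; decide
  simp_rw [this]
  rw [Finset.sum_add_distrib, ← Finset.mul_sum, Finset.sum_boole, Finset.sum_boole]
  simp [n1, n2]

lemma type_cond {C : Submodule (ZMod 5) V} (h : Good C) (c : V) (hc : c ∈ C) :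
    n1 c + n2 c ≤ 24 ∧ (n1 c + 4 * n2 c) % 5 = 0 ∧
      ((n1 c = 0 ∧ n2 c = 0) ∨ 10 ≤ n1 c + n2 c) := by
  refine ⟨?_, ?_, ?_⟩
  · rw [← hamming_eq]
    simpa using (hammingNorm_le_card_fintype (x := c))
  · have h1 := (h.dual c).mp hc c hc
    rw [sq_sum, ZMod.natCast_eq_zero_iff] at h1
    omega
  · by_cases h0 : c = 0
    · left
      have : hammingNorm c = 0 := by simp [h0]
      rw [hamming_eq] at this
      omega
    · right
      rw [← hamming_eq]
      exact h.wt c hc h0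

lemma certA : ∀ a < 25, ∀ b < 25, (a + b ≤ 24 ∧ (a + 4 * b) % 5 = 0 ∧
    ((a = 0 ∧ b = 0) ∨ 10 ≤ a + b)) →
    evalP lamA a b = (if a + b = 0 then -202702500000000 else 0)
      + 141750000000 * ((if (a = 20 ∧ b = 0) ∨ (a = 0 ∧ b = 20) then 1 else 0)
        - (if (a = 10 ∧ b = 0) ∨ (a = 0 ∧ b = 10) then 1 else 0)) := by
  decide +kernel

lemma certB : ∀ a < 25, ∀ b < 25, (a + b ≤ 24 ∧ (a + 4 * b) % 5 = 0 ∧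
    ((a = 0 ∧ b = 0) ∨ 10 ≤ a + b)) →
    evalP lamB a b = 15750000000 * (2 * (if (a = 20 ∧ b = 0) ∨ (a = 0 ∧ b = 20) then 1 else 0)
        + (if (a = 21 ∧ b = 1) ∨ (a = 1 ∧ b = 21) then 1 else 0)) := by
  decide +kernel

lemma totA : totP lamA = -352390500000000 := by decide +kernel
lemma totB : totP lamB = 0 := by decide +kernel

open Classical in
lemma counts {C : Submodule (ZMod 5) V} (h : Good C) :
    (∀ c ∈ C, ¬ ((n1 c = 20 ∧ n2 c = 0) ∨ (n1 c = 0 ∧ n2 c = 20))) ∧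
    (Finset.univ.filter (fun c : C => (n1 c = 10 ∧ n2 c = 0) ∨ (n1 c = 0 ∧ n2 c = 10))).card
      = 1056 := by
  have hA := sum_evalP h lamA (by decide)
  have hB := sum_evalP h lamB (by decide)
  rw [totA] at hA
  rw [totB] at hB
  have tc := fun c : C => type_cond h c c.2
  have cA := fun c : C => certA (n1 c) (by have := tc c; omega) (n2 c) (by have := tc c; omega) (tc c)
  have cB := fun c : C => certB (n1 c) (by have := tc c; omega) (n2 c) (by have := tc c; omega) (tc c)
  rw [Finset.sum_congr rfl (fun c _ => cA c), Finset.sum_add_distrib, ← Finset.mul_sum,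
    Finset.sum_sub_distrib, Finset.sum_boole, Finset.sum_boole] at hA
  rw [Finset.sum_congr rfl (fun c _ => cB c), ← Finset.mul_sum, Finset.sum_add_distrib,
    ← Finset.mul_sum, Finset.sum_boole, Finset.sum_boole] at hB
  have h0 : ∑ c : C, (if n1 c + n2 c = 0 then (-202702500000000 : ℤ) else 0) = -202702500000000 := by
    rw [Finset.sum_eq_single (0 : C)]
    · simp [n1, n2]
      have : ∀ x : ZMod 5, x = 0 → ¬ (0 = (4 : ZMod 5)) ∧ ¬ (0 = (2 : ZMod 5)) ∧ ¬ (0 = (3 : ZMod 5)) := by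
        decide
      have := this 0 rfl
      simp [this]
    · intro c _ hc
      rw [if_neg]
      rw [← hamming_eq]
      simpa using hc
    · simp
  rw [h0] at hA
  have h20 : (Finset.univ.filter
      (fun c : C => (n1 c = 20 ∧ n2 c = 0) ∨ (n1 c = 0 ∧ n2 c = 20))).card = 0 := by omega
  refine ⟨?_, by omega⟩
  intro c hc hcc
  rw [Finset.card_eq_zero, Finset.filter_eq_empty_iff] at h20
  exact h20 (Finset.mem_univ (⟨c, hc⟩ : C)) hcc

end SD24

namespace SD24

attribute [local instance] fact_five

open Matrix

abbrev W := Fin 24 → ℤ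

/-- The abstract properties of the norm `2` vectors of the lattice attached to the code. -/
structure RS (L : AddSubgroup W) (R : Finset W) : Prop where
  mem : ∀ v, v ∈ R ↔ v ∈ L ∧ v ⬝ᵥ v = 10
  ent : ∀ v ∈ R, ∀ i, v i = -1 ∨ v i = 0 ∨ v i = 1
  dvd : ∀ v ∈ L, ∀ w ∈ L, (5 : ℤ) ∣ v ⬝ᵥ w
  meet : ∀ v ∈ R, ∀ w ∈ R, v ⬝ᵥ w = 0 → ∃ i, v i * w i ≠ 0
  card : R.card = 528

variable {L : AddSubgroup W} {R : Finset W}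

lemma dot_self_nonneg (v : W) : 0 ≤ v ⬝ᵥ v :=
  Finset.sum_nonneg fun i _ => mul_self_nonneg (v i)

lemma RS.self (h : RS L R) {v : W} (hv : v ∈ R) : v ⬝ᵥ v = 10 := ((h.mem v).mp hv).2
lemma RS.inL (h : RS L R) {v : W} (hv : v ∈ R) : v ∈ L := ((h.mem v).mp hv).1

lemma RS.cases (h : RS L R) {v w : W} (hv : v ∈ R) (hw : w ∈ R) :
    v ⬝ᵥ w = -10 ∨ v ⬝ᵥ w = -5 ∨ v ⬝ᵥ w = 0 ∨ v ⬝ᵥ w = 5 ∨ v ⬝ᵥ w = 10 := by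
  have h1 := dot_self_nonneg (v - w)
  have h2 := dot_self_nonneg (v + w)
  have h3 := h.dvd v (h.inL hv) w (h.inL hw)
  have h4 := dotProduct_comm w v
  have h5 := h.self hv
  have h6 := h.self hw
  simp only [sub_dotProduct, dotProduct_sub, add_dotProduct, dotProduct_add] at h1 h2
  omega

lemma RS.eq_of (h : RS L R) {v w : W} (hv : v ∈ R) (hw : w ∈ R) (e : v ⬝ᵥ w = 10) : v = w := by
  have : (v - w) ⬝ᵥ (v - w) = 0 := by
    simp only [sub_dotProduct, dotProduct_sub]
    rw [dotProduct_comm w v, h.self hv, h.self hw, e]; norm_num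
  exact sub_eq_zero.mp (dotProduct_self_eq_zero.mp this)

lemma RS.eq_neg_of (h : RS L R) {v w : W} (hv : v ∈ R) (hw : w ∈ R) (e : v ⬝ᵥ w = -10) :
    v = -w := by
  have : (v + w) ⬝ᵥ (v + w) = 0 := by
    simp only [add_dotProduct, dotProduct_add]
    rw [dotProduct_comm w v, h.self hv, h.self hw, e]; norm_num
  exact eq_neg_of_add_eq_zero_left (dotProduct_self_eq_zero.mp this)

lemma RS.neg_mem (h : RS L R) {v : W} (hv : v ∈ R) : -v ∈ R := by
  rw [h.mem]
  refine ⟨L.neg_mem (h.inL hv), ?_⟩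
  simp [h.self hv]

lemma RS.sub_mem (h : RS L R) {v w : W} (hv : v ∈ R) (hw : w ∈ R) (e : v ⬝ᵥ w = 5) :
    v - w ∈ R := by
  rw [h.mem]
  refine ⟨L.sub_mem (h.inL hv) (h.inL hw), ?_⟩
  simp only [sub_dotProduct, dotProduct_sub]
  rw [dotProduct_comm w v, h.self hv, h.self hw, e]; norm_num

lemma RS.agree (h : RS L R) {v w : W} (hv : v ∈ R) (hw : w ∈ R) (e : v ⬝ᵥ w = 5) (i : Fin 24) :
    0 ≤ v i * w i := by
  have h1 := h.ent _ (h.sub_mem hv hw e) i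
  rw [Pi.sub_apply] at h1
  revert h1
  rcases h.ent v hv i with a | a | a <;> rcases h.ent w hw i with b | b | b <;>
    rw [a, b] <;> decide

/-- number of coordinates at which the two vectors agree (and are nonzero) -/
def ag (u v : W) : ℤ := ∑ i, if u i * v i = 1 then 1 else 0

lemma RS.ag_pos (h : RS L R) {v w : W} (hv : v ∈ R) (hw : w ∈ R) (e : v ⬝ᵥ w = 0) :
    1 ≤ ag v w := by
  obtain ⟨i, hi⟩ := h.meet v hv w hw e
  by_contra hlt
  have hnn : ∀ j ∈ (Finset.univ : Finset (Fin 24)),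
      (0 : ℤ) ≤ if v j * w j = 1 then 1 else 0 := by
    intro j _; split_ifs <;> norm_num
  have h0 : ag v w = 0 := le_antisymm (by omega) (Finset.sum_nonneg hnn)
  have h1 := (Finset.sum_eq_zero_iff_of_nonneg hnn).mp h0
  have h2 : ∀ j ∈ (Finset.univ : Finset (Fin 24)), v j * w j ≤ 0 := by
    intro j hj
    have := h1 j hj
    revert this
    rcases h.ent v hv j with a | a | a <;> rcases h.ent w hw j with b | b | b <;>
      rw [a, b] <;> decide
  have h3 := (Finset.sum_eq_zero_iff_of_nonpos h2).mp e
  exact hi (h3 i (Finset.mem_univ i))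

lemma RS.cn_bound (h : RS L R) {y z : W} (hy : y ∈ R) (hz : z ∈ R) (e : y ⬝ᵥ z = 0)
    (U : Finset W) (hU : ∀ u ∈ U, u ∈ R ∧ u ⬝ᵥ y = 5 ∧ u ⬝ᵥ z = 5) :
    ag y z * U.card ≤ 2 * (4 + 2 * ag y z) := by
  have bar : ∀ u ∈ U, y + z - u ∈ R := by
    intro u hu
    obtain ⟨h1, h2, h3⟩ := hU u hu
    rw [h.mem]
    refine ⟨L.sub_mem (L.add_mem (h.inL hy) (h.inL hz)) (h.inL h1), ?_⟩
    simp only [sub_dotProduct, dotProduct_sub, add_dotProduct, dotProduct_add]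
    rw [dotProduct_comm y u, dotProduct_comm z u, dotProduct_comm z y,
      h.self hy, h.self hz, h.self h1, e, h2, h3]
    norm_num
  let q : Fin 24 → ℤ := fun i => (1 - y i * y i) * (1 - z i * z i)
  have hq : ∑ i, q i = 4 + 2 * ag y z := by
    have : ∀ i, q i = 1 - y i * y i - z i * z i +
        2 * (if y i * z i = 1 then 1 else 0) - y i * z i := by
      intro i
      simp only [q]
      rcases h.ent y hy i with a | a | a <;> rcases h.ent z hz i with b | b | b <;>
        rw [a, b] <;> norm_num
    simp_rw [this]
    rw [Finset.sum_sub_distrib, Finset.sum_add_distrib, Finset.sum_sub_distrib,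
      Finset.sum_sub_distrib, ← Finset.mul_sum]
    have e1 := h.self hy
    have e2 := h.self hz
    have e3 := e
    unfold dotProduct at e1 e2 e3
    rw [e1, e2, e3]
    simp [ag]
  have hu : ∀ u ∈ U, ∑ i, q i * (u i * u i) = ag y z := by
    intro u hu
    obtain ⟨h1, h2, h3⟩ := hU u hu
    have hb := bar u hu
    have : ∀ i, q i * (u i * u i) = u i * u i - u i * y i - u i * z i +
        (if y i * z i = 1 then 1 else 0) := by
      intro i
      have a1 := h.agree h1 hy h2 i
      have a2 := h.agree h1 hz h3 i
      have a3 := h.ent _ hb i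
      rw [Pi.sub_apply, Pi.add_apply] at a3
      simp only [q]
      revert a1 a2 a3
      rcases h.ent y hy i with a | a | a <;> rcases h.ent z hz i with b | b | b <;>
        rcases h.ent u h1 i with c | c | c <;>
        rw [a, b, c] <;> decide
    simp_rw [this]
    rw [Finset.sum_add_distrib, Finset.sum_sub_distrib, Finset.sum_sub_distrib]
    have e1 := h.self h1
    unfold dotProduct at e1 h2 h3
    rw [e1, h2, h3]
    simp [ag]
  have key : ∀ i, q i * ∑ u ∈ U, u i * u i ≤ q i * 2 := by
    intro i
    by_cases hqi : y i = 0 ∧ z i = 0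
    · have hq1 : q i = 1 := by simp [q, hqi.1, hqi.2]
      rw [hq1, one_mul, one_mul]
      have uniq : ∀ s : ℤ, s ≠ 0 → (U.filter (fun u => u i = s)).card ≤ 1 := by
        intro s hs
        rw [Finset.card_le_one]
        intro u hu u' hu'
        rw [Finset.mem_filter] at hu hu'
        obtain ⟨h1, h2, h3⟩ := hU u hu.1
        obtain ⟨h1', h2', h3'⟩ := hU u' hu'.1
        have hb := bar u hu.1
        have hip : u' ⬝ᵥ (y + z - u) = 10 - u' ⬝ᵥ u := by
          simp only [dotProduct_sub, dotProduct_add]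
          rw [h2', h3']; norm_num
        have hbi : (y + z - u) i = - s := by
          rw [Pi.sub_apply, Pi.add_apply, hqi.1, hqi.2, hu.2]; ring
        have hss : 0 < s * s := mul_self_pos.mpr hs
        rcases h.cases h1' h1 with c | c | c | c | c
        · have := h.cases h1' hb; omega
        · have := h.cases h1' hb; omega
        · rw [c] at hip
          have := h.eq_of h1' hb (by omega)
          have h7 := congrFun this i
          rw [hbi, hu'.2] at h7
          omega
        · rw [c] at hip
          have := h.agree h1' hb (by omega) i
          rw [hbi, hu'.2] at this
          nlinarith
        · exact (h.eq_of h1' h1 c).symm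
      have : ∀ u ∈ U, u i * u i = (if u i = 1 then 1 else 0) + (if u i = -1 then 1 else 0) := by
        intro u hu
        rcases h.ent u (hU u hu).1 i with c | c | c <;> rw [c] <;> norm_num
      rw [Finset.sum_congr rfl this, Finset.sum_add_distrib, Finset.sum_boole, Finset.sum_boole]
      have t1 := uniq 1 (by norm_num)
      have t2 := uniq (-1) (by norm_num)
      have t1' : ((U.filter (fun u => u i = 1)).card : ℤ) ≤ 1 := by exact_mod_cast t1
      have t2' : ((U.filter (fun u => u i = -1)).card : ℤ) ≤ 1 := by exact_mod_cast t2
      linarith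
    · have hq0 : q i = 0 := by
        simp only [q]
        revert hqi
        rcases h.ent y hy i with a | a | a <;> rcases h.ent z hz i with b | b | b <;>
          rw [a, b] <;> decide
      rw [hq0]; simp
  have : ag y z * U.card = ∑ i, q i * ∑ u ∈ U, u i * u i := by
    simp_rw [Finset.mul_sum]
    rw [Finset.sum_comm, Finset.sum_congr rfl hu]
    simp [mul_comm]
  rw [this]
  calc _ ≤ ∑ i, q i * 2 := Finset.sum_le_sum fun i _ => key i
    _ = _ := by rw [← Finset.sum_mul, hq]; ring

/-- common neighbours of `x` and `z` -/
def Dl (R : Finset W) (x z : W) : Finset W := R.filter (fun y => y ⬝ᵥ x = 5 ∧ y ⬝ᵥ z = 5)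

lemma mem_Dl {x z y : W} : y ∈ Dl R x z ↔ y ∈ R ∧ y ⬝ᵥ x = 5 ∧ y ⬝ᵥ z = 5 := by
  simp [Dl]

lemma RS.dl_ip (h : RS L R) {x z : W} (hx : x ∈ R) (hz : z ∈ R) (e : x ⬝ᵥ z = 5)
    {u w : W} (hu : u ∈ Dl R x z) (hw : w ∈ Dl R x z) :
    u = w ∨ u ⬝ᵥ w = 5 ∨ u ⬝ᵥ w = 0 := by
  obtain ⟨u1, u2, u3⟩ := mem_Dl.mp hu
  obtain ⟨w1, w2, w3⟩ := mem_Dl.mp hw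
  rcases h.cases u1 w1 with c | c | c | c | c
  · have := h.eq_neg_of u1 w1 c
    rw [this, neg_dotProduct] at u2
    omega
  · exfalso
    have hs : u + w ∈ R := by
      have := h.sub_mem u1 (h.neg_mem w1) (by rw [dotProduct_neg]; omega)
      simpa using this
    have e1 := h.eq_of hs hx (by rw [add_dotProduct]; omega)
    have e2 := h.eq_of hs hz (by rw [add_dotProduct]; omega)
    rw [← e1, ← e2, h.self hs] at e
    omega
  · exact Or.inr (Or.inr c)
  · exact Or.inr (Or.inl c)
  · exact Or.inl (h.eq_of u1 w1 c)

lemma RS.dl_third (h : RS L R) {x z : W} (hx : x ∈ R) (hz : z ∈ R) (e : x ⬝ᵥ z = 5)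
    {u w : W} (hu : u ∈ Dl R x z) (hw : w ∈ Dl R x z) (c : u ⬝ᵥ w = 0) :
    x + z - u - w ∈ Dl R x z := by
  obtain ⟨u1, u2, u3⟩ := mem_Dl.mp hu
  obtain ⟨w1, w2, w3⟩ := mem_Dl.mp hw
  have a1 := h.self hx
  have a2 := h.self hz
  have a3 := h.self u1
  have a4 := h.self w1
  have b1 := dotProduct_comm z x
  have b2 := dotProduct_comm x u
  have b3 := dotProduct_comm x w
  have b4 := dotProduct_comm z u
  have b5 := dotProduct_comm z w
  have b6 := dotProduct_comm w u
  rw [mem_Dl, h.mem]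
  refine ⟨⟨L.sub_mem (L.sub_mem (L.add_mem (h.inL hx) (h.inL hz)) (h.inL u1)) (h.inL w1), ?_⟩,
    ?_, ?_⟩ <;>
  simp only [sub_dotProduct, dotProduct_sub, add_dotProduct, dotProduct_add] <;> omega

/-- elements of `Dl` orthogonal to `u` -/
def Oo (R : Finset W) (x z u : W) : Finset W := (Dl R x z).filter (fun v => v ⬝ᵥ u = 0)

lemma RS.half (h : RS L R) {x z : W} (hx : x ∈ R) (hz : z ∈ R) (e : x ⬝ᵥ z = 5)
    {u w : W} (hu : u ∈ Dl R x z) (hw : w ∈ Dl R x z) (c : u ⬝ᵥ w = 5) :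
    (Oo R x z u).card = 2 * ((Oo R x z u).filter (fun v => v ⬝ᵥ w = 0)).card := by
  obtain ⟨u1, u2, u3⟩ := mem_Dl.mp hu
  obtain ⟨w1, w2, w3⟩ := mem_Dl.mp hw
  have b1 := dotProduct_comm x u
  have b2 := dotProduct_comm z u
  have b3 := dotProduct_comm x w
  have b4 := dotProduct_comm z w
  have a3 := h.self u1
  rw [← Finset.card_filter_add_card_filter_not (s := Oo R x z u) (fun v => v ⬝ᵥ w = 0), two_mul]
  congr 1
  have pr : ∀ v ∈ Oo R x z u, x + z - u - v ∈ Oo R x z u ∧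
      (v ⬝ᵥ w = 0 ∨ v ⬝ᵥ w = 5) ∧ (x + z - u - v) ⬝ᵥ w = 5 - v ⬝ᵥ w := by
    intro v hv
    rw [Oo, Finset.mem_filter] at hv
    have hvu : u ⬝ᵥ v = 0 := by rw [dotProduct_comm]; exact hv.2
    refine ⟨?_, ?_, ?_⟩
    · rw [Oo, Finset.mem_filter]
      refine ⟨h.dl_third hx hz e hu hv.1 hvu, ?_⟩
      simp only [sub_dotProduct, add_dotProduct]
      omega
    · rcases h.dl_ip hx hz e hv.1 hw with d | d | d
      · rw [d] at hvu; omega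
      · exact Or.inr d
      · exact Or.inl d
    · simp only [sub_dotProduct, add_dotProduct]
      omega
  refine Finset.card_bij' (fun v _ => x + z - u - v) (fun v _ => x + z - u - v) ?_ ?_ ?_ ?_
  · intro v hv
    rw [Finset.mem_filter] at hv ⊢
    have := pr v hv.1
    exact ⟨this.1, by omega⟩
  · intro v hv
    rw [Finset.mem_filter] at hv ⊢
    have := pr v hv.1
    exact ⟨this.1, by omega⟩
  · intro v _; abel
  · intro v _; abel

lemma RS.oo_eq (h : RS L R) {x z : W} (hx : x ∈ R) (hz : z ∈ R) (e : x ⬝ᵥ z = 5)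
    {u w : W} (hu : u ∈ Dl R x z) (hw : w ∈ Dl R x z) (c : u ⬝ᵥ w = 5) :
    (Oo R x z u).card = (Oo R x z w).card := by
  rw [h.half hx hz e hu hw c, h.half hx hz e hw hu (by rw [dotProduct_comm]; exact c)]
  congr 2
  ext v
  simp only [Oo, Finset.mem_filter]
  tauto

end SD24

namespace SD24

attribute [local instance] fact_five

open Matrix

variable {L : AddSubgroup W} {R : Finset W}

lemma ag_point (a b x z : ℤ) (ha : a = -1 ∨ a = 0 ∨ a = 1) (hb : b = -1 ∨ b = 0 ∨ b = 1)
    (hx : x = -1 ∨ x = 0 ∨ x = 1) (hz : z = -1 ∨ z = 0 ∨ z = 1) :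
    ∀ c : ℤ, a + b + c = x + z → (c = -1 ∨ c = 0 ∨ c = 1) → 0 ≤ x * z → 0 ≤ a * x → 0 ≤ a * z → 0 ≤ b * x → 0 ≤ b * z →
    0 ≤ c * x → 0 ≤ c * z →
    ((if a * b = 1 then 1 else 0) + (if a * c = 1 then 1 else 0) + (if b * c = 1 then 1 else 0) : ℤ)
      = x * z := by
  intro c hc
  obtain rfl : c = x + z - a - b := by omega
  clear hc
  rcases ha with rfl | rfl | rfl <;> rcases hb with rfl | rfl | rfl <;>
  rcases hx with rfl | rfl | rfl <;> rcases hz with rfl | rfl | rfl <;> decide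

lemma RS.ag_sum (h : RS L R) {x z : W} (hx : x ∈ R) (hz : z ∈ R) (e : x ⬝ᵥ z = 5)
    {u w t : W} (hu : u ∈ Dl R x z) (hw : w ∈ Dl R x z) (ht : t ∈ Dl R x z)
    (hs : u + w + t = x + z) : ag u w + ag u t + ag w t = 5 := by
  obtain ⟨u1, u2, u3⟩ := mem_Dl.mp hu
  obtain ⟨w1, w2, w3⟩ := mem_Dl.mp hw
  obtain ⟨t1, t2, t3⟩ := mem_Dl.mp ht
  rw [← e]
  unfold ag dotProduct
  rw [← Finset.sum_add_distrib, ← Finset.sum_add_distrib]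
  refine Finset.sum_congr rfl fun i _ => ?_
  exact ag_point (u i) (w i) (x i) (z i) (h.ent _ u1 i) (h.ent _ w1 i) (h.ent _ hx i)
    (h.ent _ hz i) (t i) (by simpa using congrFun hs i) (h.ent _ t1 i) (h.agree hx hz e i)
    (h.agree u1 hx u2 i) (h.agree u1 hz u3 i) (h.agree w1 hx w2 i) (h.agree w1 hz w3 i)
    (h.agree t1 hx t2 i) (h.agree t1 hz t3 i)

lemma RS.oo_other (h : RS L R) {x z : W} (hx : x ∈ R) (hz : z ∈ R) (e : x ⬝ᵥ z = 5)
    {u w t v : W} (hu : u ∈ Dl R x z) (hw : w ∈ Dl R x z)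
    (hs : u + w + t = x + z) (hv : v ∈ Oo R x z t) (n1 : v ≠ u) (n2 : v ≠ w) :
    v ⬝ᵥ u = 5 ∧ v ⬝ᵥ w = 5 := by
  rw [Oo, Finset.mem_filter] at hv
  obtain ⟨v1, v2, v3⟩ := mem_Dl.mp hv.1
  have hh := congrArg (fun s => v ⬝ᵥ s) hs
  simp only [dotProduct_add] at hh
  have a1 := h.dl_ip hx hz e hv.1 hu
  have a2 := h.dl_ip hx hz e hv.1 hw
  have := hv.2
  rcases a1 with a1 | a1 | a1
  · exact absurd a1 n1
  all_goals
    rcases a2 with a2 | a2 | a2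
    · exact absurd a2 n2
    all_goals omega

lemma RS.oo_tri (h : RS L R) {x z : W} (hx : x ∈ R) (hz : z ∈ R) (e : x ⬝ᵥ z = 5)
    {u w t : W} (hu : u ∈ Dl R x z) (hw : w ∈ Dl R x z)
    (hs : u + w + t = x + z) (ht : 2 < (Oo R x z t).card) :
    (Oo R x z u).card = (Oo R x z w).card := by
  have : ((Oo R x z t) \ {u, w}).Nonempty := by
    rw [← Finset.card_pos]
    have := Finset.le_card_sdiff {u, w} (Oo R x z t)
    have h2 : ({u, w} : Finset W).card ≤ 2 := Finset.card_le_two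
    omega
  obtain ⟨v, hv⟩ := this
  simp only [Finset.mem_sdiff, Finset.mem_insert, Finset.mem_singleton, not_or] at hv
  obtain ⟨c1, c2⟩ := h.oo_other hx hz e hu hw hs hv.1 hv.2.1 hv.2.2
  have hvD : v ∈ Dl R x z := (Finset.mem_filter.mp hv.1).1
  rw [← h.oo_eq hx hz e hvD hu c1, h.oo_eq hx hz e hvD hw c2]

lemma RS.pair_bound (h : RS L R) {x z : W} (hx : x ∈ R) (hz : z ∈ R) (e : x ⬝ᵥ z = 5)
    {u w t : W} (hu : u ∈ Dl R x z) (hw : w ∈ Dl R x z) (c : u ⬝ᵥ w = 0)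
    (hs : u + w + t = x + z) : ag u w * ((Oo R x z t).card - 2) ≤ 8 := by
  obtain ⟨u1, u2, u3⟩ := mem_Dl.mp hu
  obtain ⟨w1, w2, w3⟩ := mem_Dl.mp hw
  have a1 := h.self hx
  have a2 := h.self hz
  have a3 := h.self u1
  have a4 := h.self w1
  have b1 := dotProduct_comm z x
  have b2 := dotProduct_comm x u
  have b3 := dotProduct_comm x w
  have b4 := dotProduct_comm z u
  have b5 := dotProduct_comm z w
  have b6 := dotProduct_comm w u
  let A := (Oo R x z t) \ {u, w}
  let B : Finset W := {x, z, u + w - x, u + w - z}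
  have q1 : (u + w - x) ⬝ᵥ x = 0 := by simp only [sub_dotProduct, add_dotProduct]; omega
  have q2 : (u + w - x) ⬝ᵥ z = 5 := by simp only [sub_dotProduct, add_dotProduct]; omega
  have q3 : (u + w - z) ⬝ᵥ x = 5 := by simp only [sub_dotProduct, add_dotProduct]; omega
  have q4 : (u + w - z) ⬝ᵥ z = 0 := by simp only [sub_dotProduct, add_dotProduct]; omega
  have ne : ∀ {p q : W} (s : W), p ⬝ᵥ s ≠ q ⬝ᵥ s → p ≠ q := by
    intro p q s h1 h2; exact h1 (by rw [h2])
  have cB : B.card = 4 := by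
    have m1 : x ≠ z := ne x (by omega)
    have m2 : x ≠ u + w - x := ne x (by omega)
    have m3 : x ≠ u + w - z := ne x (by omega)
    have m4 : z ≠ u + w - x := ne x (by omega)
    have m5 : z ≠ u + w - z := ne z (by omega)
    have m6 : u + w - x ≠ u + w - z := ne x (by omega)
    simp only [B]
    rw [Finset.card_insert_of_notMem (by simp only [Finset.mem_insert, Finset.mem_singleton]; tauto),
      Finset.card_insert_of_notMem (by simp only [Finset.mem_insert, Finset.mem_singleton]; tauto),
      Finset.card_insert_of_notMem (by simp only [Finset.mem_singleton]; tauto),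
      Finset.card_singleton]
  have cA : (Oo R x z t).card ≤ A.card + 2 := by
    have := Finset.le_card_sdiff {u, w} (Oo R x z t)
    have h2 : ({u, w} : Finset W).card ≤ 2 := Finset.card_le_two
    simp only [A]
    omega
  have dj : Disjoint A B := by
    rw [Finset.disjoint_left]
    intro v hv hvB
    simp only [A, Finset.mem_sdiff] at hv
    obtain ⟨v1, v2, v3⟩ := mem_Dl.mp (Finset.mem_filter.mp hv.1).1
    simp only [B, Finset.mem_insert, Finset.mem_singleton] at hvB
    rcases hvB with rfl | rfl | rfl | rfl <;> omega
  have key := h.cn_bound u1 w1 c (A ∪ B) (by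
    intro v hv
    rw [Finset.mem_union] at hv
    rcases hv with hv | hv
    · simp only [A, Finset.mem_sdiff, Finset.mem_insert, Finset.mem_singleton, not_or] at hv
      exact ⟨(mem_Dl.mp (Finset.mem_filter.mp hv.1).1).1,
        h.oo_other hx hz e hu hw hs hv.1 hv.2.1 hv.2.2⟩
    · simp only [B, Finset.mem_insert, Finset.mem_singleton] at hv
      rcases hv with rfl | rfl | rfl | rfl
      · exact ⟨hx, by omega, by omega⟩
      · exact ⟨hz, by omega, by omega⟩
      · refine ⟨(h.mem _).mpr ⟨L.sub_mem (L.add_mem (h.inL u1) (h.inL w1)) (h.inL hx), ?_⟩, ?_, ?_⟩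
          <;> simp only [sub_dotProduct, dotProduct_sub, add_dotProduct, dotProduct_add] <;> omega
      · refine ⟨(h.mem _).mpr ⟨L.sub_mem (L.add_mem (h.inL u1) (h.inL w1)) (h.inL hz), ?_⟩, ?_, ?_⟩
          <;> simp only [sub_dotProduct, dotProduct_sub, add_dotProduct, dotProduct_add] <;> omega)
  rw [Finset.card_union_of_disjoint dj, cB] at key
  have hp := h.ag_pos u1 w1 c
  have cA' : ((Oo R x z t).card : ℤ) ≤ A.card + 2 := by exact_mod_cast cA
  push_cast at key
  nlinarith

lemma RS.oo_count (h : RS L R) {x z : W} (hx : x ∈ R) (hz : z ∈ R) (e : x ⬝ᵥ z = 5)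
    {u w t : W} (hu : u ∈ Dl R x z) (hw : w ∈ Dl R x z) (ht : t ∈ Dl R x z)
    (c1 : u ⬝ᵥ w = 0) (c2 : u ⬝ᵥ t = 0) (c3 : w ⬝ᵥ t = 0)
    (hs : u + w + t = x + z) :
    (Dl R x z).card + 3 ≤ (Oo R x z u).card + (Oo R x z w).card + (Oo R x z t).card := by
  have a3 := h.self (mem_Dl.mp hu).1
  have a4 := h.self (mem_Dl.mp hw).1
  have a5 := h.self (mem_Dl.mp ht).1
  have d1 := dotProduct_comm w u
  have d2 := dotProduct_comm t u
  have d3 := dotProduct_comm t w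
  have one : ∀ s ∈ Dl R x z, ∑ v ∈ Dl R x z, (if v = s then 1 else 0) = 1 := by
    intro s hs
    rw [Finset.sum_ite_eq' (Dl R x z) s]
    simp [hs]
  have l : (Dl R x z).card + 3 = ∑ v ∈ Dl R x z, (1 + (if v = u then 1 else 0) +
      (if v = w then 1 else 0) + (if v = t then 1 else 0)) := by
    rw [Finset.sum_add_distrib, Finset.sum_add_distrib, Finset.sum_add_distrib,
      one u hu, one w hw, one t ht]
    simp
  rw [l]
  unfold Oo
  rw [Finset.card_filter, Finset.card_filter, Finset.card_filter, ← Finset.sum_add_distrib,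
    ← Finset.sum_add_distrib]
  refine Finset.sum_le_sum fun v hv => ?_
  obtain ⟨v1, v2, v3⟩ := mem_Dl.mp hv
  have ne : ∀ {p q : W} (s : W), p ⬝ᵥ s ≠ q ⬝ᵥ s → p ≠ q := by
    intro p q s h1 h2; exact h1 (by rw [h2])
  have m1 : u ≠ w := ne u (by omega)
  have m2 : u ≠ t := ne u (by omega)
  have m3 : w ≠ t := ne w (by omega)
  by_cases g1 : v = u
  · rw [g1]
    simp only [m1, m2, c1, c2, a3]; simp
  by_cases g2 : v = w
  · rw [g2]
    simp only [m1.symm, m3, d1, c1, c3, a4]; simp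
  by_cases g3 : v = t
  · rw [g3]
    simp only [m2.symm, m3.symm, d2, d3, c2, c3, a5]; simp
  simp only [g1, g2, g3, if_false]
  have hh := congrArg (fun s => v ⬝ᵥ s) hs
  simp only [dotProduct_add] at hh
  have a1 := (h.dl_ip hx hz e hv hu).resolve_left g1
  have a2 := (h.dl_ip hx hz e hv hw).resolve_left g2
  have a3 := (h.dl_ip hx hz e hv ht).resolve_left g3
  split_ifs <;> omega

lemma RS.clique (h : RS L R) {x z : W} (hx : x ∈ R) (hz : z ∈ R) (e : x ⬝ᵥ z = 5)
    (hc : 19 ≤ (Dl R x z).card) :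
    ∀ u ∈ Dl R x z, ∀ w ∈ Dl R x z, u ≠ w → u ⬝ᵥ w = 5 := by
  intro u hu w hw huw
  rcases h.dl_ip hx hz e hu hw with c | c | c
  · exact absurd c huw
  · exact c
  exfalso
  have ht := h.dl_third hx hz e hu hw c
  set t := x + z - u - w with htdef
  have hs : u + w + t = x + z := by rw [htdef]; abel
  have hs2 : u + t + w = x + z := by rw [htdef]; abel
  have hs3 : w + t + u = x + z := by rw [htdef]; abel
  obtain ⟨u1, u2, u3⟩ := mem_Dl.mp hu
  obtain ⟨w1, w2, w3⟩ := mem_Dl.mp hw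
  obtain ⟨t1, t2, t3⟩ := mem_Dl.mp ht
  have b6 := dotProduct_comm w u
  have a3 := h.self u1
  have a4 := h.self w1
  have c2 : u ⬝ᵥ t = 0 := by
    rw [htdef]; simp only [dotProduct_sub, dotProduct_add]; omega
  have c3 : w ⬝ᵥ t = 0 := by
    rw [htdef]; simp only [dotProduct_sub, dotProduct_add]; omega
  have k0 := h.ag_sum hx hz e hu hw ht hs
  have k1 := h.pair_bound hx hz e hu hw c hs
  have k2 := h.pair_bound hx hz e hu ht c2 hs2
  have k3 := h.pair_bound hx hz e hw ht c3 hs3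
  have p1 := h.ag_pos u1 w1 c
  have p2 := h.ag_pos u1 t1 c2
  have p3 := h.ag_pos w1 t1 c3
  have s1 := h.oo_tri hx hz e hu hw hs
  have s2 := h.oo_tri hx hz e hu ht hs2
  have s3 := h.oo_tri hx hz e hw ht hs3
  have k := h.oo_count hx hz e hu hw ht c c2 c3 hs
  have two : ∀ {p q s : W}, q ∈ Dl R x z → s ∈ Dl R x z → q ⬝ᵥ p = 0 → s ⬝ᵥ p = 0 →
      q ⬝ᵥ s = 0 → 2 ≤ (Oo R x z p).card := by
    intro p q s hq hs e1 e2 e3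
    have hne : q ≠ s := by
      rintro rfl
      have := h.self (mem_Dl.mp hq).1
      omega
    rw [← Finset.card_pair hne]
    refine Finset.card_le_card ?_
    intro v hv
    simp only [Finset.mem_insert, Finset.mem_singleton] at hv
    rw [Oo, Finset.mem_filter]
    rcases hv with rfl | rfl
    · exact ⟨hq, e1⟩
    · exact ⟨hs, e2⟩
  have d2 := dotProduct_comm t u
  have d3 := dotProduct_comm t w
  have o1 := two (p := u) hw ht (by omega) (by omega) c3
  have o2 := two (p := w) hu ht (by omega) (by omega) c2
  have o3 := two (p := t) hu hw (by omega) (by omega) c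
  generalize (Oo R x z u).card = x1 at *
  generalize (Oo R x z w).card = x2 at *
  generalize (Oo R x z t).card = x3 at *
  generalize ag u w = y1 at *
  generalize ag u t = y2 at *
  generalize ag w t = y3 at *
  have i1 : y1 ≤ 3 := by omega
  have i2 : y2 ≤ 3 := by omega
  have i3 : y3 = 5 - y1 - y2 := by omega
  subst i3
  clear k0
  interval_cases y1 <;> interval_cases y2 <;> omega

end SD24

namespace SD24

attribute [local instance] fact_five

open Matrix

variable {L : AddSubgroup W} {R : Finset W}

/-- neighbours of `x` -/
def Zz (R : Finset W) (x : W) : Finset W := R.filter (fun y => y ⬝ᵥ x = 5)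

lemma mem_Zz {x y : W} : y ∈ Zz R x ↔ y ∈ R ∧ y ⬝ᵥ x = 5 := by simp [Zz]

lemma RS.zcases (h : RS L R) {x y z : W} (hx : x ∈ R) (hy : y ∈ Zz R x) (hz : z ∈ Zz R x) :
    y = z ∨ y = x - z ∨ y ∈ Dl R x z ∨ x - y ∈ Dl R x z := by
  obtain ⟨y1, y2⟩ := mem_Zz.mp hy
  obtain ⟨z1, z2⟩ := mem_Zz.mp hz
  have a1 := h.self hx
  have b1 := dotProduct_comm x y
  have b2 := dotProduct_comm x z
  rcases h.cases y1 z1 with c | c | c | c | c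
  · have := h.eq_neg_of y1 z1 c
    rw [this, neg_dotProduct] at y2
    omega
  · have hs : y + z ∈ R := by
      have := h.sub_mem y1 (h.neg_mem z1) (by rw [dotProduct_neg]; omega)
      simpa using this
    have e1 := h.eq_of hs hx (by rw [add_dotProduct]; omega)
    right; left
    rw [← e1]; abel
  · right; right; right
    rw [mem_Dl]
    refine ⟨h.sub_mem hx y1 (by omega), ?_, ?_⟩ <;> rw [sub_dotProduct] <;> omega
  · right; right; left
    exact mem_Dl.mpr ⟨y1, y2, c⟩
  · left; exact h.eq_of y1 z1 c

lemma RS.z_bound (h : RS L R) {x z : W} (hx : x ∈ R) (hz : z ∈ Zz R x) :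
    (Zz R x).card ≤ 2 + 2 * (Dl R x z).card := by
  have hsub : Zz R x ⊆ ({z, x - z} : Finset W) ∪
      (Dl R x z ∪ (Dl R x z).image (fun v => x - v)) := by
    intro y hy
    simp only [Finset.mem_union, Finset.mem_insert, Finset.mem_singleton, Finset.mem_image]
    rcases h.zcases hx hy hz with c | c | c | c
    · exact Or.inl (Or.inl c)
    · exact Or.inl (Or.inr c)
    · exact Or.inr (Or.inl c)
    · exact Or.inr (Or.inr ⟨x - y, c, by abel⟩)
  have t1 := Finset.card_le_card hsub
  have t2 := Finset.card_union_le ({z, x - z} : Finset W)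
    (Dl R x z ∪ (Dl R x z).image (fun v => x - v))
  have t3 := Finset.card_union_le (Dl R x z) ((Dl R x z).image (fun v => x - v))
  have t4 := Finset.card_image_le (s := Dl R x z) (f := fun v => x - v)
  have t5 : ({z, x - z} : Finset W).card ≤ 2 := Finset.card_le_two
  omega

/-! ### Frames -/

abbrev M := Fin 24 × Fin 24 → ℤ

def oo (a : W) : M := fun p => a p.1 * a p.2
def II : M := fun p => if p.1 = p.2 then 1 else 0

lemma oo_oo (a b : W) : oo a ⬝ᵥ oo b = (a ⬝ᵥ b) ^ 2 := by
  unfold oo dotProduct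
  rw [Fintype.sum_prod_type, sq, Finset.sum_mul_sum]
  refine Finset.sum_congr rfl fun i _ => Finset.sum_congr rfl fun j _ => ?_
  ring

lemma oo_II (a : W) : oo a ⬝ᵥ II = a ⬝ᵥ a := by
  unfold oo II dotProduct
  rw [Fintype.sum_prod_type]
  refine Finset.sum_congr rfl fun i _ => ?_
  simp

lemma II_II : II ⬝ᵥ II = 24 := by
  unfold II dotProduct
  rw [Fintype.sum_prod_type]
  simp

lemma frame (S Q : M) (n D : ℤ) (hD : 0 < D) (h1 : S ⬝ᵥ Q = 0) (h2 : Q ⬝ᵥ II = D * n)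
    (h3 : Q ⬝ᵥ Q = D ^ 2 * n) : (S ⬝ᵥ II) ^ 2 ≤ (24 - n) * (S ⬝ᵥ S) := by
  have cs : (S ⬝ᵥ (D • II - Q)) ^ 2 ≤ (S ⬝ᵥ S) * ((D • II - Q) ⬝ᵥ (D • II - Q)) := by
    have := Finset.sum_mul_sq_le_sq_mul_sq Finset.univ S (D • II - Q)
    simpa only [dotProduct, sq] using this
  have e0 := dotProduct_comm II Q
  have e1 : S ⬝ᵥ (D • II - Q) = D * (S ⬝ᵥ II) := by
    rw [dotProduct_sub, dotProduct_smul, h1, smul_eq_mul, sub_zero]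
  have e2 : (D • II - Q) ⬝ᵥ (D • II - Q) = D ^ 2 * (24 - n) := by
    simp only [sub_dotProduct, dotProduct_sub, smul_dotProduct, dotProduct_smul, smul_eq_mul]
    rw [e0, h2, h3, II_II]; ring
  rw [e1, e2] at cs
  have hD2 : 0 < D ^ 2 := by positivity
  have : D ^ 2 * (S ⬝ᵥ II) ^ 2 ≤ D ^ 2 * ((24 - n) * (S ⬝ᵥ S)) := by nlinarith
  exact le_of_mul_le_mul_left this hD2

def Clq (R K : Finset W) : Prop := K ⊆ R ∧ ∀ a ∈ K, ∀ b ∈ K, a ≠ b → a ⬝ᵥ b = 5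

def Qq (K : Finset W) : M := ((K.card : ℤ) + 1) • (∑ k ∈ K, oo k) - oo (∑ k ∈ K, k)

lemma RS.clq_s (h : RS L R) {K : Finset W} (hK : Clq R K) {k : W} (hk : k ∈ K) :
    k ⬝ᵥ (∑ k ∈ K, k) = 5 * (K.card + 1) := by
  rw [dotProduct_sum]
  have : ∀ a ∈ K, k ⬝ᵥ a = 5 + (if a = k then 5 else 0) := by
    intro a ha
    split_ifs with c
    · rw [c, h.self (hK.1 hk)]; norm_num
    · rw [hK.2 k hk a ha (Ne.symm c)]; norm_num
  rw [Finset.sum_congr rfl this, Finset.sum_add_distrib, Finset.sum_ite_eq' K k]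
  simp [hk]; ring

lemma RS.clq_ss (h : RS L R) {K : Finset W} (hK : Clq R K) :
    (∑ k ∈ K, k) ⬝ᵥ (∑ k ∈ K, k) = 5 * K.card * (K.card + 1) := by
  rw [sum_dotProduct, Finset.sum_congr rfl (fun k hk => h.clq_s hK hk)]
  simp; ring

lemma RS.clq_sq (h : RS L R) {K : Finset W} (hK : Clq R K) :
    (∑ k ∈ K, oo k) ⬝ᵥ (∑ k ∈ K, oo k) = 25 * K.card * (K.card + 3) := by
  have row : ∀ k ∈ K, oo k ⬝ᵥ (∑ k ∈ K, oo k) = 25 * (K.card + 3) := by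
    intro k hk
    rw [dotProduct_sum]
    have : ∀ a ∈ K, oo k ⬝ᵥ oo a = 25 + (if a = k then 75 else 0) := by
      intro a ha
      rw [oo_oo]
      split_ifs with c
      · rw [c, h.self (hK.1 hk)]; norm_num
      · rw [hK.2 k hk a ha (Ne.symm c)]; norm_num
    rw [Finset.sum_congr rfl this, Finset.sum_add_distrib, Finset.sum_ite_eq' K k]
    simp [hk]; ring
  rw [sum_dotProduct, Finset.sum_congr rfl row]
  simp; ring

lemma RS.Q_II (h : RS L R) {K : Finset W} (hK : Clq R K) :
    Qq K ⬝ᵥ II = (5 * (K.card + 1)) * K.card := by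
  have : ∀ k ∈ K, oo k ⬝ᵥ II = 10 := fun k hk => by rw [oo_II, h.self (hK.1 hk)]
  rw [Qq, sub_dotProduct, smul_dotProduct, sum_dotProduct, Finset.sum_congr rfl this, oo_II,
    h.clq_ss hK]
  simp; ring

lemma RS.Q_Q (h : RS L R) {K : Finset W} (hK : Clq R K) :
    Qq K ⬝ᵥ Qq K = (5 * (K.card + 1)) ^ 2 * K.card := by
  have : ∀ k ∈ K, oo k ⬝ᵥ oo (∑ k ∈ K, k) = (5 * (K.card + 1)) ^ 2 :=
    fun k hk => by rw [oo_oo, h.clq_s hK hk]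
  have e1 : (∑ k ∈ K, oo k) ⬝ᵥ oo (∑ k ∈ K, k) = K.card * (5 * (K.card + 1)) ^ 2 := by
    rw [sum_dotProduct, Finset.sum_congr rfl this]
    simp
  have e2 := dotProduct_comm (oo (∑ k ∈ K, k)) (∑ k ∈ K, oo k)
  simp only [Qq, sub_dotProduct, dotProduct_sub, smul_dotProduct, dotProduct_smul, smul_eq_mul]
  rw [e2, e1, h.clq_sq hK, oo_oo, h.clq_ss hK]
  ring

lemma orth_Q {K : Finset W} {y : W} (hy : ∀ k ∈ K, y ⬝ᵥ k = 0) : oo y ⬝ᵥ Qq K = 0 := by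
  have e1 : y ⬝ᵥ (∑ k ∈ K, k) = 0 := by
    rw [dotProduct_sum]; exact Finset.sum_eq_zero hy
  rw [Qq, dotProduct_sub, dotProduct_smul, dotProduct_sum, oo_oo, e1,
    Finset.sum_eq_zero (fun k hk => by rw [oo_oo, hy k hk]; norm_num)]
  simp

lemma RS.frame_two (h : RS L R) {K Y : Finset W} (hK : Clq R K) (hY : Y ⊆ R)
    (ho : ∀ y ∈ Y, ∀ k ∈ K, y ⬝ᵥ k = 0) :
    (10 * (Y.card : ℤ)) ^ 2 ≤ (24 - K.card) * ∑ y ∈ Y, ∑ y' ∈ Y, (y ⬝ᵥ y') ^ 2 := by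
  have := frame (∑ y ∈ Y, oo y) (Qq K) K.card (5 * (K.card + 1)) (by positivity)
    (by rw [sum_dotProduct]; exact Finset.sum_eq_zero fun y hy => orth_Q (ho y hy))
    (h.Q_II hK) (h.Q_Q hK)
  have e1 : (∑ y ∈ Y, oo y) ⬝ᵥ II = 10 * (Y.card : ℤ) := by
    rw [sum_dotProduct, Finset.sum_congr rfl (fun y hy => by rw [oo_II, h.self (hY hy)])]
    simp [mul_comm]
  have e2 : (∑ y ∈ Y, oo y) ⬝ᵥ (∑ y ∈ Y, oo y) = ∑ y ∈ Y, ∑ y' ∈ Y, (y ⬝ᵥ y') ^ 2 := by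
    rw [sum_dotProduct]
    refine Finset.sum_congr rfl fun y _ => ?_
    rw [dotProduct_sum]
    exact Finset.sum_congr rfl fun y' _ => oo_oo _ _
  rwa [e1, e2] at this

lemma RS.frame_three (h : RS L R) {K K' : Finset W} (hK : Clq R K) (hK' : Clq R K')
    (ho : ∀ y ∈ K', ∀ k ∈ K, y ⬝ᵥ k = 0) (hpos : 0 < K'.card) :
    K.card + K'.card ≤ 24 := by
  have hs : ∀ k ∈ K, (∑ y ∈ K', y) ⬝ᵥ k = 0 := by
    intro k hk
    rw [sum_dotProduct]
    exact Finset.sum_eq_zero fun y hy => ho y hy k hk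
  have := frame (Qq K') (Qq K) K.card (5 * (K.card + 1)) (by positivity)
    (by
      rw [Qq, sub_dotProduct, smul_dotProduct, sum_dotProduct,
        Finset.sum_eq_zero (fun y hy => orth_Q (ho y hy)), orth_Q hs]
      simp)
    (h.Q_II hK) (h.Q_Q hK)
  rw [h.Q_II hK', h.Q_Q hK'] at this
  have hp : (0 : ℤ) < (5 * (K'.card + 1)) ^ 2 * K'.card := by positivity
  have h2 : ((5 * ((K'.card : ℤ) + 1)) ^ 2 * K'.card) * K'.card ≤
      ((5 * ((K'.card : ℤ) + 1)) ^ 2 * K'.card) * (24 - K.card) := by linarith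
  have := le_of_mul_le_mul_left h2 hp
  omega

lemma RS.degree (h : RS L R) {y : W} (hy : y ∈ R) {Y : Finset W} (hY : Y ⊆ R) :
    ∑ y' ∈ Y, (y ⬝ᵥ y') ^ 2 ≤ 200 + 50 * ((Zz R y).card : ℤ) := by
  have h1 : ∑ y' ∈ Y, (y ⬝ᵥ y') ^ 2 ≤ ∑ y' ∈ R, (y ⬝ᵥ y') ^ 2 :=
    Finset.sum_le_sum_of_subset_of_nonneg hY fun _ _ _ => sq_nonneg _
  have h2 : ∀ y' ∈ R, (y ⬝ᵥ y') ^ 2 ≤ 100 * (if y' = y then 1 else 0) +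
      100 * (if y' = -y then 1 else 0) + 25 * (if y' ⬝ᵥ y = 5 then 1 else 0) +
      25 * (if y' ⬝ᵥ y = -5 then 1 else 0) := by
    intro y' hy'
    rw [dotProduct_comm]
    rcases h.cases hy' hy with c | c | c | c | c
    · have := h.eq_neg_of hy' hy c
      rw [if_pos this, c]
      norm_num; split_ifs <;> norm_num
    · rw [c]; norm_num; split_ifs <;> norm_num
    · rw [c]; norm_num; split_ifs <;> norm_num
    · rw [c]; norm_num; split_ifs <;> norm_num
    · have := h.eq_of hy' hy c
      rw [if_pos this, c]
      norm_num; split_ifs <;> norm_num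
  have h3 := Finset.sum_le_sum h2
  rw [Finset.sum_add_distrib, Finset.sum_add_distrib, Finset.sum_add_distrib,
    ← Finset.mul_sum, ← Finset.mul_sum, ← Finset.mul_sum, ← Finset.mul_sum,
    Finset.sum_ite_eq' R y, Finset.sum_ite_eq' R (-y), Finset.sum_boole, Finset.sum_boole,
    if_pos hy, if_pos (h.neg_mem hy)] at h3
  have h4 : (R.filter (fun y' => y' ⬝ᵥ y = -5)).card ≤ (Zz R y).card := by
    refine Finset.card_le_card_of_injOn (fun v => -v) ?_ (neg_injective.injOn)
    intro v hv
    have hv' := Finset.mem_filter.mp hv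
    exact mem_Zz.mpr ⟨h.neg_mem hv'.1, by rw [neg_dotProduct, hv'.2]; norm_num⟩
  have h4' : ((R.filter (fun y' => y' ⬝ᵥ y = -5)).card : ℤ) ≤ (Zz R y).card := by exact_mod_cast h4
  have h5 : R.filter (fun y' => y' ⬝ᵥ y = 5) = Zz R y := rfl
  rw [h5] at h3
  linarith

lemma RS.average (h : RS L R) {K Y : Finset W} (hK : Clq R K) (hY : Y ⊆ R)
    (ho : ∀ y ∈ Y, ∀ k ∈ K, y ⬝ᵥ k = 0) (hn : Y.Nonempty) (h24 : K.card ≤ 24) :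
    ∃ y ∈ Y, 100 * (Y.card : ℤ) ≤ (24 - K.card) * (200 + 50 * ((Zz R y).card : ℤ)) := by
  by_contra hc
  push Not at hc
  have f := h.frame_two hK hY ho
  have h24' : (0 : ℤ) ≤ 24 - K.card := by omega
  have g : ∑ y ∈ Y, (24 - (K.card : ℤ)) * (200 + 50 * ((Zz R y).card : ℤ)) <
      ∑ y ∈ Y, 100 * (Y.card : ℤ) := Finset.sum_lt_sum_of_nonempty hn hc
  have g2 : ∑ y ∈ Y, ∑ y' ∈ Y, (y ⬝ᵥ y') ^ 2 ≤ ∑ y ∈ Y, (200 + 50 * ((Zz R y).card : ℤ)) :=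
    Finset.sum_le_sum fun y hy => h.degree (hY hy) hY
  rw [← Finset.mul_sum] at g
  have g3 := mul_le_mul_of_nonneg_left g2 h24'
  simp only [Finset.sum_const, nsmul_eq_mul] at g
  nlinarith

end SD24

namespace SD24

attribute [local instance] fact_five

open Matrix

variable {L : AddSubgroup W} {R : Finset W}

lemma RS.big_clq (h : RS L R) {x z : W} (hx : x ∈ R) (hz : z ∈ R) (e : x ⬝ᵥ z = 5)
    (hc : 19 ≤ (Dl R x z).card) :
    Clq R (insert x (insert z (Dl R x z))) ∧
      (insert x (insert z (Dl R x z))).card = (Dl R x z).card + 2 := by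
  have a1 := h.self hx
  have a2 := h.self hz
  have b1 := dotProduct_comm z x
  have cl := h.clique hx hz e hc
  refine ⟨⟨?_, ?_⟩, ?_⟩
  · intro v hv
    simp only [Finset.mem_insert] at hv
    rcases hv with rfl | rfl | hv
    · exact hx
    · exact hz
    · exact (mem_Dl.mp hv).1
  · intro v hv w hw hne
    simp only [Finset.mem_insert] at hv hw
    rcases hv with rfl | rfl | hv <;> rcases hw with rfl | rfl | hw
    · exact absurd rfl hne
    · exact e
    · rw [dotProduct_comm]; exact (mem_Dl.mp hw).2.1
    · omega
    · exact absurd rfl hne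
    · rw [dotProduct_comm]; exact (mem_Dl.mp hw).2.2
    · exact (mem_Dl.mp hv).2.1
    · exact (mem_Dl.mp hv).2.2
    · exact cl v hv w hw hne
  · have m1 : z ∉ Dl R x z := by
      intro hv
      have := (mem_Dl.mp hv).2.2
      omega
    have m2 : x ∉ insert z (Dl R x z) := by
      intro hv
      rw [Finset.mem_insert] at hv
      rcases hv with rfl | hv
      · omega
      · have := (mem_Dl.mp hv).2.1
        omega
    rw [Finset.card_insert_of_notMem m2, Finset.card_insert_of_notMem m1]

lemma RS.exists_max (h : RS L R) : ∃ K, Clq R K ∧ 21 ≤ K.card ∧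
    ∀ K', Clq R K' → K'.card ≤ K.card := by
  classical
  have hR : R.Nonempty := by rw [← Finset.card_pos, h.card]; norm_num
  obtain ⟨x, hx, hx2⟩ := h.average (K := ∅) (Y := R) ⟨by simp, by simp⟩ (le_refl R)
    (by simp) hR (by simp)
  rw [h.card] at hx2
  norm_num at hx2
  have hz : 40 ≤ (Zz R x).card := by omega
  obtain ⟨z, hzz⟩ : (Zz R x).Nonempty := by rw [← Finset.card_pos]; omega
  have hb := h.z_bound hx hzz
  obtain ⟨z1, z2⟩ := mem_Zz.mp hzz
  have big := h.big_clq hx z1 (by rw [dotProduct_comm]; exact z2) (by omega)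
  have hne : (R.powerset.filter (fun K => Clq R K)).Nonempty :=
    ⟨_, Finset.mem_filter.mpr ⟨Finset.mem_powerset.mpr big.1.1, big.1⟩⟩
  obtain ⟨K, hK, hmax⟩ := Finset.exists_max_image _ Finset.card hne
  have hmax' : ∀ K', Clq R K' → K'.card ≤ K.card := fun K' hK' =>
    hmax K' (Finset.mem_filter.mpr ⟨Finset.mem_powerset.mpr hK'.1, hK'⟩)
  refine ⟨K, (Finset.mem_filter.mp hK).2, ?_, hmax'⟩
  have := hmax' _ big.1
  omega

lemma RS.nbr (h : RS L R) {K : Finset W} (hK : Clq R K) (h21 : 21 ≤ K.card)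
    (hmax : ∀ K', Clq R K' → K'.card ≤ K.card) {k y : W} (hk : k ∈ K) (hy : y ∈ R)
    (e : y ⬝ᵥ k = 5) : y ∈ K ∨ k - y ∈ K := by
  obtain ⟨k', hk', hne⟩ := Finset.exists_mem_ne (by omega : 1 < K.card) k
  have e2 := hK.2 k hk k' hk' hne.symm
  have sub : (K.erase k).erase k' ⊆ Dl R k k' := by
    intro v hv
    simp only [Finset.mem_erase] at hv
    exact mem_Dl.mpr ⟨hK.1 hv.2.2, hK.2 v hv.2.2 k hk hv.2.1, hK.2 v hv.2.2 k' hk' hv.1⟩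
  have c1 := Finset.card_le_card sub
  rw [Finset.card_erase_of_mem (Finset.mem_erase.mpr ⟨hne, hk'⟩), Finset.card_erase_of_mem hk] at c1
  have big := h.big_clq (hK.1 hk) (hK.1 hk') e2 (by omega)
  have sub2 : K ⊆ insert k (insert k' (Dl R k k')) := by
    intro v hv
    simp only [Finset.mem_insert]
    by_cases v1 : v = k
    · exact Or.inl v1
    by_cases v2 : v = k'
    · exact Or.inr (Or.inl v2)
    exact Or.inr (Or.inr (sub (Finset.mem_erase.mpr ⟨v2, Finset.mem_erase.mpr ⟨v1, hv⟩⟩)))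
  have eq := Finset.eq_of_subset_of_card_le sub2 (hmax _ big.1)
  have dK : ∀ v ∈ Dl R k k', v ∈ K := by
    intro v hv
    rw [eq]
    exact Finset.mem_insert_of_mem (Finset.mem_insert_of_mem hv)
  rcases h.zcases (hK.1 hk) (mem_Zz.mpr ⟨hy, e⟩)
    (mem_Zz.mpr ⟨hK.1 hk', by rw [dotProduct_comm]; exact e2⟩) with c | c | c | c
  · left; rw [c]; exact hk'
  · right; rw [c]; simpa using hk'
  · left; exact dK _ c
  · right; exact dK _ c

/-- the root system of type `A` generated by a clique -/
def Ar (K : Finset W) : Finset W := ((insert 0 K).offDiag).image (fun p => p.1 - p.2)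

lemma mem_Ar {K : Finset W} {v : W} :
    v ∈ Ar K ↔ ∃ a b, (a = 0 ∨ a ∈ K) ∧ (b = 0 ∨ b ∈ K) ∧ a ≠ b ∧ a - b = v := by
  simp only [Ar, Finset.mem_image, Finset.mem_offDiag, Finset.mem_insert, Prod.exists]
  constructor
  · rintro ⟨a, b, ⟨h1, h2, h3⟩, h4⟩
    exact ⟨a, b, h1, h2, h3, h4⟩
  · rintro ⟨a, b, h1, h2, h3, h4⟩
    exact ⟨a, b, ⟨h1, h2, h3⟩, h4⟩

lemma RS.dist (h : RS L R) {K : Finset W} (hK : Clq R K) {a b : W} (ha : a = 0 ∨ a ∈ K)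
    (hb : b = 0 ∨ b ∈ K) (hne : a ≠ b) : (a - b) ⬝ᵥ (a - b) = 10 := by
  rcases ha with rfl | ha <;> rcases hb with rfl | hb
  · exact absurd rfl hne
  · simpa using h.self (hK.1 hb)
  · simpa using h.self (hK.1 ha)
  · have c1 := hK.2 a ha b hb hne
    have c2 := dotProduct_comm b a
    have c3 := h.self (hK.1 ha)
    have c4 := h.self (hK.1 hb)
    simp only [sub_dotProduct, dotProduct_sub]
    omega

lemma RS.ar_card (h : RS L R) {K : Finset W} (hK : Clq R K) :
    (Ar K).card = K.card * (K.card + 1) := by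
  have z : (0 : W) ∉ K := by
    intro hz
    have := h.self (hK.1 hz)
    simp at this
  have dn : ∀ {a b : W}, (a = 0 ∨ a ∈ K) → (b = 0 ∨ b ∈ K) → (a - b) ⬝ᵥ (a - b) ≤ 10 := by
    intro a b ha hb
    by_cases hne : a = b
    · rw [hne]; simp
    · exact (h.dist hK ha hb hne).le
  rw [Ar, Finset.card_image_of_injOn, Finset.offDiag_card, Finset.card_insert_of_notMem z]
  · rw [← Nat.mul_sub_one]; simp [mul_comm]
  · rintro ⟨a, b⟩ hp ⟨c, d⟩ hq hpq
    simp only [Finset.coe_offDiag, Set.mem_offDiag, Finset.mem_coe, Finset.mem_insert] at hp hq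
    simp only at hpq
    obtain ⟨a1, b1, n1⟩ := hp
    obtain ⟨c1, d1, n2⟩ := hq
    have e1 := h.dist hK a1 b1 n1
    have e2 : (a - b) ⬝ᵥ (c - d) = 10 := by rw [← hpq]; exact e1
    have e3 := dn a1 d1
    have e4 := dn b1 c1
    have e5 := dot_self_nonneg (b - d)
    have hac : a = c := by
      by_contra hne
      have e6 := h.dist hK a1 c1 hne
      simp only [sub_dotProduct, dotProduct_sub] at e1 e2 e3 e4 e5 e6
      have s1 := dotProduct_comm a b
      have s2 := dotProduct_comm a c
      have s3 := dotProduct_comm a d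
      have s4 := dotProduct_comm b c
      have s5 := dotProduct_comm b d
      omega
    have hbd : b = d := by
      rw [hac] at hpq
      exact sub_right_injective hpq
    rw [hac, hbd]

lemma RS.ar_sub (h : RS L R) {K : Finset W} (hK : Clq R K) : Ar K ⊆ R := by
  intro v hv
  obtain ⟨a, b, ha, hb, hne, rfl⟩ := mem_Ar.mp hv
  have inL : ∀ {a : W}, (a = 0 ∨ a ∈ K) → a ∈ L := by
    intro a ha
    rcases ha with rfl | ha
    · exact L.zero_mem
    · exact h.inL (hK.1 ha)
  exact (h.mem _).mpr ⟨L.sub_mem (inL ha) (inL hb), h.dist hK ha hb hne⟩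

lemma ar_orth {K : Finset W} {y v : W} (hy : ∀ k ∈ K, y ⬝ᵥ k = 0) (hv : v ∈ Ar K) :
    v ⬝ᵥ y = 0 := by
  obtain ⟨a, b, ha, hb, hne, rfl⟩ := mem_Ar.mp hv
  have : ∀ {a : W}, (a = 0 ∨ a ∈ K) → y ⬝ᵥ a = 0 := by
    intro a ha
    rcases ha with rfl | ha
    · simp
    · exact hy a ha
  rw [dotProduct_comm, dotProduct_sub, this ha, this hb, sub_zero]

lemma RS.dich (h : RS L R) {K : Finset W} (hK : Clq R K) (h21 : 21 ≤ K.card)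
    (hmax : ∀ K', Clq R K' → K'.card ≤ K.card) {y : W} (hy : y ∈ R) :
    y ∈ Ar K ∨ ∀ k ∈ K, y ⬝ᵥ k = 0 := by
  by_cases ho : ∀ k ∈ K, y ⬝ᵥ k = 0
  · exact Or.inr ho
  left
  push Not at ho
  obtain ⟨k, hk, hne⟩ := ho
  have kR := hK.1 hk
  have nz : ∀ {v : W}, v ∈ R → v ≠ 0 := by
    rintro v hv rfl
    have := h.self hv
    simp at this
  have five : ∀ {v : W}, v ∈ R → v ⬝ᵥ k = 5 → v ∈ Ar K := by
    intro v hv hv5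
    rw [mem_Ar]
    rcases h.nbr hK h21 hmax hk hv hv5 with c | c
    · exact ⟨v, 0, Or.inr c, Or.inl rfl, nz hv, by simp⟩
    · refine ⟨k, k - v, Or.inr hk, Or.inr c, ?_, by abel⟩
      intro hh
      apply nz hv
      have : v = k - (k - v) := by abel
      rw [this, ← hh, sub_self]
  have ng : ∀ {v : W}, -v ∈ Ar K → v ∈ Ar K := by
    intro v hv
    rw [mem_Ar] at hv ⊢
    obtain ⟨a, b, ha, hb, hab, hh⟩ := hv
    refine ⟨b, a, hb, ha, hab.symm, ?_⟩
    rw [← neg_neg v, ← hh]; abel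
  rcases h.cases hy kR with c | c | c | c | c
  · have := h.eq_neg_of hy kR c
    exact mem_Ar.mpr ⟨0, k, Or.inl rfl, Or.inr hk, (nz kR).symm, by rw [this]; simp⟩
  · exact ng (five (h.neg_mem hy) (by rw [neg_dotProduct, c]; norm_num))
  · exact absurd c hne
  · exact five hy c
  · have := h.eq_of hy kR c
    exact mem_Ar.mpr ⟨k, 0, Or.inr hk, Or.inl rfl, nz kR, by rw [this]; simp⟩

theorem RS.false (h : RS L R) : False := by
  classical
  obtain ⟨K, hK, h21, hmax⟩ := h.exists_max
  have cA := h.ar_card hK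
  have cA2 := Finset.card_le_card (h.ar_sub hK)
  rw [h.card, cA] at cA2
  have h22 : K.card ≤ 22 := by
    by_contra hc
    have : 23 ≤ K.card := by omega
    nlinarith
  let Y := R.filter (fun y => ∀ k ∈ K, y ⬝ᵥ k = 0)
  have hYR : Y ⊆ R := Finset.filter_subset _ _
  have hYo : ∀ y ∈ Y, ∀ k ∈ K, y ⬝ᵥ k = 0 := fun y hy => (Finset.mem_filter.mp hy).2
  have hsub : R ⊆ Ar K ∪ Y := by
    intro y hy
    rw [Finset.mem_union]
    rcases h.dich hK h21 hmax hy with c | c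
    · exact Or.inl c
    · exact Or.inr (Finset.mem_filter.mpr ⟨hy, c⟩)
  have hcard : 528 ≤ K.card * (K.card + 1) + Y.card := by
    have t1 := Finset.card_le_card hsub
    have t2 := Finset.card_union_le (Ar K) Y
    rw [h.card] at t1
    omega
  have hnbr : ∀ y ∈ Y, ∀ w ∈ R, w ⬝ᵥ y = 5 → w ∈ Y := by
    intro y hy w hw e
    rcases h.dich hK h21 hmax hw with c | c
    · have := ar_orth (hYo y hy) c
      omega
    · exact Finset.mem_filter.mpr ⟨hw, c⟩
  have hn : K.card = 21 ∨ K.card = 22 := by omega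
  have hYn : Y.Nonempty := by
    rw [← Finset.card_pos]
    rcases hn with e | e <;> rw [e] at hcard <;> omega
  obtain ⟨y, hy, hav⟩ := h.average hK hYR hYo hYn (by omega)
  rcases hn with e | e
  · rw [e] at hcard hav
    have hz : 40 ≤ (Zz R y).card := by push_cast at hav; omega
    obtain ⟨z, hzz⟩ : (Zz R y).Nonempty := by rw [← Finset.card_pos]; omega
    have hb := h.z_bound (hYR hy) hzz
    obtain ⟨z1, z2⟩ := mem_Zz.mp hzz
    have big := h.big_clq (hYR hy) z1 (by rw [dotProduct_comm]; exact z2) (by omega)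
    have := h.frame_three hK big.1 (by
      intro v hv
      apply hYo
      simp only [Finset.mem_insert] at hv
      rcases hv with rfl | rfl | hv
      · exact hy
      · exact hnbr y hy _ z1 z2
      · obtain ⟨v1, v2, v3⟩ := mem_Dl.mp hv
        exact hnbr y hy _ v1 v2) (by omega)
    omega
  · rw [e] at hcard hav
    have hz : 18 ≤ (Zz R y).card := by push_cast at hav; omega
    obtain ⟨z, hzz⟩ : (Zz R y).Nonempty := by rw [← Finset.card_pos]; omega
    have hb := h.z_bound (hYR hy) hzz
    obtain ⟨z1, z2⟩ := mem_Zz.mp hzz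
    obtain ⟨w, hw⟩ : (Dl R y z).Nonempty := by rw [← Finset.card_pos]; omega
    obtain ⟨w1, w2, w3⟩ := mem_Dl.mp hw
    have yR := hYR hy
    have a1 := h.self yR
    have a2 := h.self z1
    have a3 := h.self w1
    have b1 := dotProduct_comm y z
    have b2 := dotProduct_comm y w
    have b3 := dotProduct_comm z w
    have n1 : y ≠ z := by rintro rfl; omega
    have n2 : y ≠ w := by rintro rfl; omega
    have n3 : z ≠ w := by rintro rfl; omega
    have c3 : ({y, z, w} : Finset W).card = 3 := by
      rw [Finset.card_insert_of_notMem (by simp [n1, n2]),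
        Finset.card_insert_of_notMem (by simp [n3]), Finset.card_singleton]
    have cl : Clq R {y, z, w} := by
      refine ⟨?_, ?_⟩
      · intro v hv
        simp only [Finset.mem_insert, Finset.mem_singleton] at hv
        rcases hv with rfl | rfl | rfl <;> assumption
      · intro v hv u hu hne
        simp only [Finset.mem_insert, Finset.mem_singleton] at hv hu
        rcases hv with rfl | rfl | rfl <;> rcases hu with rfl | rfl | rfl <;>
          first
          | exact absurd rfl hne
          | omega
    have := h.frame_three hK cl (by
      intro v hv
      apply hYo
      simp only [Finset.mem_insert, Finset.mem_singleton] at hv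
      rcases hv with rfl | rfl | rfl
      · exact hy
      · exact hnbr y hy _ z1 z2
      · exact hnbr y hy _ w1 w2) (by omega)
    omega

end SD24

namespace SD24

attribute [local instance] fact_five

open Matrix

/-- reduction modulo `5` -/
def red : W →+ V where
  toFun v := fun i => (v i : ZMod 5)
  map_zero' := by ext i; simp
  map_add' v w := by ext i; simp

lemma red_apply (v : W) (i : Fin 24) : red v i = (v i : ZMod 5) := rfl

def Lat (C : Submodule (ZMod 5) V) : AddSubgroup W := C.toAddSubgroup.comap red

lemma mem_Lat {C : Submodule (ZMod 5) V} {v : W} : v ∈ Lat C ↔ red v ∈ C := Iff.rfl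

open Classical in
noncomputable def Rt (C : Submodule (ZMod 5) V) : Finset W :=
  (Fintype.piFinset fun _ => Finset.Icc (-1 : ℤ) 1).filter (fun v => v ∈ Lat C ∧ v ⬝ᵥ v = 10)

lemma ent_of {C : Submodule (ZMod 5) V} (h : Good C) {v : W} (hv : red v ∈ C)
    (e : v ⬝ᵥ v = 10) (i : Fin 24) : v i = -1 ∨ v i = 0 ∨ v i = 1 := by
  have le : ∀ j, v j * v j ≤ 10 := by
    intro j
    rw [← e]
    exact Finset.single_le_sum (f := fun k => v k * v k) (fun k _ => mul_self_nonneg (v k))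
      (Finset.mem_univ j)
  have bd : ∀ j, -3 ≤ v j ∧ v j ≤ 3 := by
    intro j
    have := le j
    constructor <;> nlinarith
  have rz : ∀ j, red v j = 0 ↔ v j = 0 := by
    intro j
    rw [red_apply, ZMod.intCast_zmod_eq_zero_iff_dvd (v j) 5]
    have := bd j
    push_cast
    omega
  have nz : red v ≠ 0 := by
    intro h0
    have : v = 0 := by
      ext j
      exact (rz j).mp (congrFun h0 j)
    rw [this] at e
    simp at e
  have w := h.wt _ hv nz
  have hn : (hammingNorm (red v) : ℤ) = ∑ j, if v j = 0 then 0 else 1 := by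
    unfold hammingNorm
    rw [Finset.card_filter]
    push_cast
    refine Finset.sum_congr rfl fun j _ => ?_
    by_cases c : v j = 0
    · simp [c, (rz j).mpr c]
    · have : ¬ red v j = 0 := fun c' => c ((rz j).mp c')
      simp [c, this]
  have nn : ∀ j ∈ (Finset.univ : Finset (Fin 24)),
      0 ≤ v j * v j - (if v j = 0 then 0 else 1) := by
    intro j _
    split_ifs with c
    · simp [c]
    · have := mul_self_pos.mpr c
      omega
  have s0 : ∑ j, (v j * v j - (if v j = 0 then 0 else 1)) = 0 := by
    apply le_antisymm _ (Finset.sum_nonneg nn)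
    rw [Finset.sum_sub_distrib, ← hn]
    have e' : ∑ j, v j * v j = 10 := e
    rw [e']
    omega
  have := (Finset.sum_eq_zero_iff_of_nonneg nn).mp s0 i (Finset.mem_univ i)
  obtain ⟨b1, b2⟩ := bd i
  revert this
  generalize v i = a at *
  interval_cases a <;> decide

lemma mem_Rt {C : Submodule (ZMod 5) V} (h : Good C) (v : W) :
    v ∈ Rt C ↔ v ∈ Lat C ∧ v ⬝ᵥ v = 10 := by
  simp only [Rt, Finset.mem_filter, Fintype.mem_piFinset, Finset.mem_Icc]
  constructor
  · exact fun hv => hv.2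
  · intro hv
    refine ⟨fun i => ?_, hv⟩
    have := ent_of h hv.1 hv.2 i
    omega

lemma type_red {v : W} (hv : ∀ i, v i = -1 ∨ v i = 0 ∨ v i = 1) :
    (n1 (red v) : ℤ) = v ⬝ᵥ v ∧ n2 (red v) = 0 := by
  constructor
  · unfold n1 dotProduct
    rw [Finset.card_filter]
    push_cast
    refine Finset.sum_congr rfl fun i _ => ?_
    rw [red_apply]
    rcases hv i with a | a | a <;> rw [a] <;> decide
  · unfold n2
    rw [Finset.card_eq_zero, Finset.filter_eq_empty_iff]
    intro i _
    rw [red_apply]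
    rcases hv i with a | a | a <;> rw [a] <;> decide

open Classical in
lemma card_T {C : Submodule (ZMod 5) V} (h : Good C) :
    (Finset.univ.filter (fun c : C => n1 c = 10 ∧ n2 c = 0)).card = 528 := by
  have hc := (counts h).2
  rw [Finset.filter_or, Finset.card_union_of_disjoint] at hc
  · have two : ∀ c : V, n1 ((2 : ZMod 5) • c) = n2 c ∧ n2 ((2 : ZMod 5) • c) = n1 c := by
      intro c
      unfold n1 n2
      constructor <;>
      · congr 1
        ext i
        simp only [Finset.mem_filter, Finset.mem_univ, true_and, Pi.smul_apply, smul_eq_mul]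
        generalize c i = a
        revert a
        decide
    have three : ∀ c : V, n1 ((3 : ZMod 5) • c) = n2 c ∧ n2 ((3 : ZMod 5) • c) = n1 c := by
      intro c
      unfold n1 n2
      constructor <;>
      · congr 1
        ext i
        simp only [Finset.mem_filter, Finset.mem_univ, true_and, Pi.smul_apply, smul_eq_mul]
        generalize c i = a
        revert a
        decide
    have six : (3 : ZMod 5) * 2 = 1 := by decide
    have six2 : (2 : ZMod 5) * 3 = 1 := by decide
    have eq : (Finset.univ.filter (fun c : C => n1 c = 10 ∧ n2 c = 0)).card =
        (Finset.univ.filter (fun c : C => n1 c = 0 ∧ n2 c = 10)).card := by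
      refine Finset.card_bij' (fun c _ => (2 : ZMod 5) • c) (fun c _ => (3 : ZMod 5) • c)
        ?_ ?_ ?_ ?_
      · intro c hc
        simp only [Finset.mem_filter, Finset.mem_univ, true_and, Submodule.coe_smul] at hc ⊢
        rw [(two c).1, (two c).2]
        exact ⟨hc.2, hc.1⟩
      · intro c hc
        simp only [Finset.mem_filter, Finset.mem_univ, true_and, Submodule.coe_smul] at hc ⊢
        rw [(three c).1, (three c).2]
        exact ⟨hc.2, hc.1⟩
      · intro c _
        rw [smul_smul, six, one_smul]
      · intro c _
        rw [smul_smul, six2, one_smul]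
    omega
  · rw [Finset.disjoint_filter]
    intro c _ h1 h2
    omega

lemma card_Rt {C : Submodule (ZMod 5) V} (h : Good C) : (Rt C).card = 528 := by
  classical
  rw [← card_T h]
  refine Finset.card_bij (fun v hv => ⟨red v, ((mem_Rt h v).mp hv).1⟩) ?_ ?_ ?_
  · intro v hv
    obtain ⟨h1, h2⟩ := (mem_Rt h v).mp hv
    have := type_red (ent_of h h1 h2)
    simp only [Finset.mem_filter, Finset.mem_univ, true_and]
    exact ⟨by omega, this.2⟩
  · intro v hv w hw e
    obtain ⟨h1, h2⟩ := (mem_Rt h v).mp hv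
    obtain ⟨h3, h4⟩ := (mem_Rt h w).mp hw
    ext i
    have e' := congrFun (Subtype.mk.inj e) i
    rw [red_apply, red_apply] at e'
    revert e'
    rcases ent_of h h1 h2 i with a | a | a <;> rcases ent_of h h3 h4 i with b | b | b <;>
      rw [a, b] <;> decide
  · intro c hc
    simp only [Finset.mem_filter, Finset.mem_univ, true_and] at hc
    let v : W := fun i => if (c : V) i = 1 then 1 else if (c : V) i = 4 then -1 else 0
    have hv : ∀ i, v i = -1 ∨ v i = 0 ∨ v i = 1 := by
      intro i
      simp only [v]
      split_ifs <;> simp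
    have hr : red v = c := by
      ext i
      have h2 := hc.2
      unfold n2 at h2
      rw [Finset.card_eq_zero, Finset.filter_eq_empty_iff] at h2
      have h3 := h2 (Finset.mem_univ i)
      rw [red_apply]
      simp only [v]
      revert h3
      generalize (c : V) i = a
      revert a
      decide
    have ht := type_red hv
    rw [hr, hc.1] at ht
    refine ⟨v, (mem_Rt h v).mpr ⟨?_, ?_⟩, Subtype.ext hr⟩
    · rw [mem_Lat, hr]; exact c.2
    · rw [← ht.1]; norm_num

lemma rs_of {C : Submodule (ZMod 5) V} (h : Good C) : RS (Lat C) (Rt C) where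
  mem := mem_Rt h
  ent v hv := ent_of h ((mem_Rt h v).mp hv).1 ((mem_Rt h v).mp hv).2
  dvd v hv w hw := by
    have := (h.dual _).mp hv _ hw
    have h2 : ((v ⬝ᵥ w : ℤ) : ZMod 5) = 0 := by
      rw [← this]
      unfold dotProduct
      push_cast
      rfl
    exact_mod_cast (ZMod.intCast_zmod_eq_zero_iff_dvd (v ⬝ᵥ w) 5).mp h2
  meet v hv w hw e := by
    by_contra hc
    push Not at hc
    obtain ⟨h1, h2⟩ := (mem_Rt h v).mp hv
    obtain ⟨h3, h4⟩ := (mem_Rt h w).mp hw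
    have ent : ∀ i, (v + w) i = -1 ∨ (v + w) i = 0 ∨ (v + w) i = 1 := by
      intro i
      have := hc i
      rw [Pi.add_apply]
      revert this
      rcases ent_of h h1 h2 i with a | a | a <;> rcases ent_of h h3 h4 i with b | b | b <;>
        rw [a, b] <;> decide
    have ht := type_red ent
    have hs : (v + w) ⬝ᵥ (v + w) = 20 := by
      have := dotProduct_comm w v
      simp only [add_dotProduct, dotProduct_add]
      omega
    rw [hs] at ht
    refine (counts h).1 (red (v + w)) ((Lat C).add_mem h1 h3) (Or.inl ⟨?_, ht.2⟩)
    have := ht.1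
    omega
  card := card_Rt h

end SD24

/-- There exists no self-dual `[24,12,10]` code over `𝔽₅`: there is no
12-dimensional linear subspace `C` of `(𝔽₅)²⁴` which equals its dual code
under the standard inner product and whose minimum Hamming weight is `10`. -/
theorem no_self_dual_24_12_10_code_over_F5 :
    ¬ ∃ C : Submodule (ZMod 5) (Fin 24 → ZMod 5),
      Module.finrank (ZMod 5) C = 12 ∧
      (∀ x : Fin 24 → ZMod 5, x ∈ C ↔ ∀ c ∈ C, ∑ i, x i * c i = 0) ∧
      (∀ c ∈ C, c ≠ 0 → 10 ≤ hammingNorm c) ∧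
      (∃ c ∈ C, c ≠ 0 ∧ hammingNorm c = 10) := by
  rintro ⟨C, h1, h2, h3, _⟩
  have hg : SD24.Good C := ⟨h1, h2, h3⟩
  exact (SD24.rs_of hg).false
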